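/- Let p and q be prime numbers with p ≡ 5 (mod 8), q ≡ 3 (mod 8), and Legendre symbol (p/q) = −1. Let L = ℚ(√2, √p, √q, i), the imaginary multiquadratic field of degree 16. Then the 2-class number of L equals 2, and this also equals the 2-class number of the imaginary quadratic field ℚ(√(−pq)). -/

import Mathlib

/-- The class number of a subfield `K` of `ℂ` (the cardinality of the class
group of its ring of integers). -/
noncomputable def classNum (K : IntermediateField ℚ ℂ) : ℕ :=
  Nat.card (ClassGroup (integralClosure ℤ K))

/-- The 2-class number of a subfield `K` of `ℂ`: the largest power of `2`
dividing its class number. -/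
noncomputable def twoClassNum (K : IntermediateField ℚ ℂ) : ℕ :=
  2 ^ ((classNum K).factorization 2)

set_option maxSynthPendingDepth 3

section GroupLemmas

variable {G : Type*} [CommGroup G]

theorem Subgroup.two_dvd_relIndex {H K : Subgroup G} (hsq : ∀ x ∈ K, x ^ 2 ∈ H)
    (hex : ∃ x ∈ K, x ∉ H) : 2 ∣ H.relIndex K := by
  obtain ⟨x, hxK, hxH⟩ := hex
  set y : K ⧸ H.subgroupOf K := QuotientGroup.mk ⟨x, hxK⟩ with hy
  have hne : y ≠ 1 := by
    rw [hy, Ne, QuotientGroup.eq_one_iff, Subgroup.mem_subgroupOf]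
    exact hxH
  have hy2 : y ^ 2 = 1 := by
    rw [hy, ← QuotientGroup.mk_pow, QuotientGroup.eq_one_iff, Subgroup.mem_subgroupOf]
    exact hsq x hxK
  rw [← orderOf_eq_prime hy2 hne]
  exact _root_.orderOf_dvd_natCard y

theorem factorization_two_card_eq_one [Finite G]
    (hG : Nat.card (powMonoidHom 2 : G →* G).ker ∣ 2) {g : G} (hg : g ^ 2 = 1)
    (hsq : ∀ y : G, y ^ 2 ≠ g) : (Nat.card G).factorization 2 = 1 := by
  set f := (powMonoidHom 2 : G →* G)
  have hgk : g ∈ f.ker := hg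
  have hg1 : g ≠ 1 := fun h => hsq 1 (by simp [h])
  have hcard : Nat.card f.ker * Nat.card f.range = Nat.card G := by
    rw [← Subgroup.index_ker, Subgroup.card_mul_index]
  have h1 : Nat.card f.ker ≠ 1 := fun h => by
    have := (Nat.card_eq_one_iff_unique.1 h).1
    exact hg1 (congrArg Subtype.val (Subsingleton.elim (⟨g, hgk⟩ : f.ker) 1))
  have h2 : Nat.card f.ker = 2 := ((Nat.dvd_prime Nat.prime_two).1 hG).resolve_left h1
  have hodd : ¬ 2 ∣ Nat.card f.range := fun h => by
    obtain ⟨y, hy⟩ := exists_prime_orderOf_dvd_card' 2 h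
    obtain ⟨z, hz⟩ := y.2
    have hy' : (y : G) ^ 2 = 1 := by
      have := pow_orderOf_eq_one y
      rw [hy] at this
      exact congrArg Subtype.val this
    obtain ⟨a, b, hab, huniv⟩ := Nat.card_eq_two_iff.1 h2
    have mem : ∀ w : f.ker, w = a ∨ w = b := fun w => by
      have : w ∈ ({a, b} : Set f.ker) := huniv ▸ Set.mem_univ w
      simpa using this
    have hy1 : (y : G) ≠ 1 := fun h => by
      have : y = 1 := Subtype.ext h
      simp [this] at hy
    have key : (y : G) = g := by
      have e1 : (⟨y, hy'⟩ : f.ker) ≠ 1 := fun h => hy1 (congrArg Subtype.val h)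
      have e2 : (⟨g, hgk⟩ : f.ker) ≠ 1 := fun h => hg1 (congrArg Subtype.val h)
      have : (⟨y, hy'⟩ : f.ker) = ⟨g, hgk⟩ := by
        rcases mem 1 with h | h <;> rcases mem ⟨y, hy'⟩ with h' | h' <;>
          rcases mem ⟨g, hgk⟩ with h'' | h'' <;> simp_all
      exact congrArg Subtype.val this
    exact hsq z (key ▸ hz)
  rw [← hcard, h2, Nat.factorization_mul two_ne_zero (fun h => hodd (by rw [h]; exact dvd_zero 2))]
  rw [Finsupp.add_apply, Nat.factorization_eq_zero_of_not_dvd hodd,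
    Nat.Prime.factorization_self Nat.prime_two]

theorem odd_card_of_card_ker_sq [Finite G]
    (hG : Nat.card (powMonoidHom 2 : G →* G).ker = 1) : Odd (Nat.card G) := by
  rw [← Nat.not_even_iff_odd, even_iff_two_dvd]
  intro h
  obtain ⟨y, hy⟩ := exists_prime_orderOf_dvd_card' 2 h
  have hy' : y ^ 2 = 1 := hy ▸ pow_orderOf_eq_one y
  have := (Nat.card_eq_one_iff_unique.1 hG).1
  have : y = 1 := congrArg Subtype.val
    (Subsingleton.elim (⟨y, hy'⟩ : (powMonoidHom 2 : G →* G).ker) 1)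
  simp [this] at hy

/-- The subgroup of squares of a commutative group. -/
def sqSubgroup (G : Type*) [CommGroup G] : Subgroup G := (powMonoidHom 2 : G →* G).range

theorem sq_mem_sqSubgroup (x : G) : x ^ 2 ∈ sqSubgroup G := ⟨x, rfl⟩

end GroupLemmas

section UnitSquares

open NumberField NumberField.Units Module

variable (K : Type*) [Field K] [NumberField K]

/-- The exponents modulo 2 of a unit with respect to a fundamental system. -/
noncomputable def unitExponentsModTwo :
    (𝓞 K)ˣ →* Multiplicative (Fin (rank K) → ZMod 2) where
  toFun u := Multiplicative.ofAdd fun i =>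
    (((basisModTorsion K).repr (Additive.ofMul (QuotientGroup.mk u)) i : ℤ) : ZMod 2)
  map_one' := by
    rw [← ofAdd_zero]
    congr 1
    funext i
    simp
  map_mul' u v := by
    rw [← ofAdd_add]
    congr 1
    funext i
    simp

theorem unitExponentsModTwo_surjective : Function.Surjective (unitExponentsModTwo K) := by
  intro c
  choose z hz using fun i => ZMod.intCast_surjective (Multiplicative.toAdd c i)
  obtain ⟨u, hu⟩ := QuotientGroup.mk_surjective
    (Additive.toMul ((basisModTorsion K).equivFun.symm z))
  refine ⟨u, ?_⟩
  change Multiplicative.ofAdd _ = _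
  rw [← ofAdd_toAdd c]
  congr 1
  funext i
  rw [← hz i, hu, ofMul_toMul, ← Basis.equivFun_apply, LinearEquiv.apply_symm_apply]

theorem two_pow_dvd_index_sqSubgroup_units :
    2 ^ (rank K + 1) ∣ (sqSubgroup (𝓞 K)ˣ).index := by
  set φ := unitExponentsModTwo K
  have hle : sqSubgroup (𝓞 K)ˣ ≤ φ.ker := by
    rintro _ ⟨y, rfl⟩
    rw [MonoidHom.mem_ker, powMonoidHom_apply, map_pow]
    generalize φ y = c
    apply Multiplicative.toAdd.injective
    funext i
    rw [toAdd_pow, toAdd_one, Pi.smul_apply, two_nsmul]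
    exact CharTwo.add_self_eq_zero _
  have hidx : φ.ker.index = 2 ^ rank K := by
    rw [Subgroup.index_ker, MonoidHom.range_eq_top.2 (unitExponentsModTwo_surjective K),
      Subgroup.card_top, Nat.card_eq_fintype_card]
    simp [Fintype.card_multiplicative]
  rw [← Subgroup.relIndex_mul_index hle, hidx, pow_succ']
  refine mul_dvd_mul_right (Subgroup.two_dvd_relIndex (fun x _ => sq_mem_sqSubgroup x) ?_) _
  by_contra hcon
  push Not at hcon
  have hsub : ∀ x : torsion K, ∃ y : torsion K, y ^ 2 = x := by
    intro x
    obtain ⟨y, hy⟩ := hcon x (by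
      change φ x = 1
      have : (QuotientGroup.mk (x : (𝓞 K)ˣ) : (𝓞 K)ˣ ⧸ torsion K) = 1 :=
        (QuotientGroup.eq_one_iff _).2 x.2
      apply Multiplicative.toAdd.injective
      funext i
      change (((basisModTorsion K).repr (Additive.ofMul (QuotientGroup.mk (x : (𝓞 K)ˣ))) i : ℤ)
        : ZMod 2) = 0
      rw [this]
      simp)
    have hy' : y ^ 2 = x := hy
    refine ⟨⟨y, ?_⟩, Subtype.ext hy'⟩
    have h2 : IsOfFinOrder (y ^ 2) := by rw [hy']; exact x.2
    exact (isOfFinOrder_pow.1 h2).resolve_right two_ne_zero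
  have hinj : Function.Injective (fun y : torsion K => y ^ 2) :=
    Finite.injective_iff_surjective.2 hsub
  have hm : (-1 : (𝓞 K)ˣ) ∈ torsion K := by
    change IsOfFinOrder _
    exact isOfFinOrder_iff_pow_eq_one.2 ⟨2, two_pos, by simp⟩
  have : (⟨-1, hm⟩ : torsion K) = 1 := hinj (by ext; simp)
  have h3 : (-1 : (𝓞 K)ˣ) = 1 := congrArg Subtype.val this
  have h4 : (-1 : 𝓞 K) = 1 := by simpa using congrArg Units.val h3
  norm_num at h4

end UnitSquares

section SelmerIndex

theorem relIndex_sqSubgroup_comap {G I : Type*} [CommGroup G] [CommGroup I] (P : G →* I)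
    (hinj : Function.Injective (powMonoidHom 2 : I →* I)) :
    (sqSubgroup G).relIndex ((sqSubgroup I).comap P) =
      (sqSubgroup G).relIndex P.ker *
        Nat.card (powMonoidHom 2 : I ⧸ P.range →* I ⧸ P.range).ker := by
  set S := (sqSubgroup I).comap P
  have hker : P.ker ≤ S := fun x hx => by
    rw [Subgroup.mem_comap, (hx : P x = 1)]
    exact one_mem _
  have hsq : sqSubgroup G ≤ S := by
    rintro _ ⟨y, rfl⟩
    exact ⟨P y, by simp⟩
  rw [← Subgroup.relIndex_mul_relIndex _ _ _ (le_sup_left : sqSubgroup G ≤ sqSubgroup G ⊔ P.ker)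
    (sup_le hsq hker), Subgroup.relIndex_sup_left]
  congr 1
  have h1 : (sqSubgroup G ⊔ P.ker).relIndex S =
      ((sqSubgroup G).map P).relIndex (S.map P) := by
    rw [Subgroup.relIndex_map_map, sup_eq_left.2 hker]
  have h2 : (sqSubgroup G).map P = P.range.map (powMonoidHom 2) := by
    ext z
    constructor
    · rintro ⟨_, ⟨y, rfl⟩, rfl⟩
      exact ⟨P y, ⟨y, rfl⟩, by simp⟩
    · rintro ⟨_, ⟨y, rfl⟩, rfl⟩
      exact ⟨y ^ 2, ⟨y, rfl⟩, by simp⟩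
  have h3 : S.map P = (P.range.comap (powMonoidHom 2)).map (powMonoidHom 2) := by
    ext z
    constructor
    · rintro ⟨x, ⟨w, hw⟩, rfl⟩
      exact ⟨w, ⟨x, hw.symm⟩, hw⟩
    · rintro ⟨w, ⟨x, hx⟩, rfl⟩
      exact ⟨x, ⟨w, hx.symm⟩, hx⟩
  rw [h1, h2, h3, Subgroup.relIndex_map_map_of_injective _ _ hinj]
  conv_lhs => rw [← QuotientGroup.ker_mk' P.range, Subgroup.relIndex_ker]
  congr 2
  rw [QuotientGroup.ker_mk']
  ext z
  constructor
  · rintro ⟨w, hw, rfl⟩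
    rw [MonoidHom.mem_ker, powMonoidHom_apply, ← map_pow, QuotientGroup.mk'_apply,
      QuotientGroup.eq_one_iff]
    exact hw
  · intro hz
    obtain ⟨w, rfl⟩ := QuotientGroup.mk'_surjective _ z
    rw [MonoidHom.mem_ker, powMonoidHom_apply, ← map_pow, QuotientGroup.mk'_apply,
      QuotientGroup.eq_one_iff] at hz
    exact ⟨w, hz, rfl⟩

end SelmerIndex

section Selmer

open NumberField IsDedekindDomain
open scoped nonZeroDivisors

variable (K : Type*) [Field K] [NumberField K]

/-- The nonzero elements of `K` generating the square of a fractional ideal. -/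
noncomputable def selmerTwo : Subgroup Kˣ :=
  (sqSubgroup (FractionalIdeal (𝓞 K)⁰ K)ˣ).comap (toPrincipalIdeal (𝓞 K) K)

theorem fractionalIdeal_sq_injective :
    Function.Injective (powMonoidHom 2 :
      (FractionalIdeal (𝓞 K)⁰ K)ˣ →* (FractionalIdeal (𝓞 K)⁰ K)ˣ) := by
  intro I J h
  have h' : (I : FractionalIdeal (𝓞 K)⁰ K) ^ 2 = (J : FractionalIdeal (𝓞 K)⁰ K) ^ 2 := by
    simpa using congrArg Units.val h
  ext1
  rw [← FractionalIdeal.finprod_heightOneSpectrum_factorization' K I.ne_zero,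
    ← FractionalIdeal.finprod_heightOneSpectrum_factorization' K J.ne_zero]
  refine finprod_congr fun v => ?_
  have := congrArg (FractionalIdeal.count K v) h'
  rw [FractionalIdeal.count_pow, FractionalIdeal.count_pow] at this
  rw [mul_left_cancel₀ (by norm_num) this]

theorem relIndex_sqSubgroup_ker_toPrincipalIdeal :
    (sqSubgroup Kˣ).relIndex (toPrincipalIdeal (𝓞 K) K).ker = (sqSubgroup (𝓞 K)ˣ).index := by
  set ι : (𝓞 K)ˣ →* Kˣ := Units.map (algebraMap (𝓞 K) K)
  have h1 : (toPrincipalIdeal (𝓞 K) K).ker = (⊤ : Subgroup (𝓞 K)ˣ).map ι := by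
    rw [← MonoidHom.range_eq_map]
    ext x
    rw [MonoidHom.mem_ker, toPrincipalIdeal_eq_iff, Units.val_one]
    constructor
    · intro h
      have hx : ∀ y : Kˣ, FractionalIdeal.spanSingleton (𝓞 K)⁰ (y : K) = 1 →
          ∃ a : 𝓞 K, algebraMap (𝓞 K) K a = y := fun y hy => by
        have := FractionalIdeal.mem_spanSingleton_self (𝓞 K)⁰ (y : K)
        rw [hy, FractionalIdeal.mem_one_iff] at this
        exact this
      obtain ⟨a, ha⟩ := hx x h
      obtain ⟨b, hb⟩ := hx x⁻¹ (by
        rw [Units.val_inv_eq_inv_val, ← FractionalIdeal.spanSingleton_inv, h, inv_one])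
      have hab : a * b = 1 := by
        apply FaithfulSMul.algebraMap_injective (𝓞 K) K
        rw [map_mul, ha, hb, map_one, Units.mul_inv]
      exact ⟨Units.mkOfMulEqOne a b hab, Units.ext ha⟩
    · rintro ⟨u, rfl⟩
      apply le_antisymm
      · rw [FractionalIdeal.spanSingleton_le_iff_mem, FractionalIdeal.mem_one_iff]
        exact ⟨u, rfl⟩
      · rw [FractionalIdeal.one_le, FractionalIdeal.mem_spanSingleton]
        exact ⟨((u⁻¹ : (𝓞 K)ˣ) : 𝓞 K), by
          rw [Algebra.smul_def, Units.coe_map, MonoidHom.coe_coe, ← map_mul, Units.inv_mul,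
            map_one]⟩
  rw [h1, ← Subgroup.relIndex_comap, Subgroup.relIndex_top_right]
  congr 1
  ext u
  constructor
  · rintro ⟨y, hy⟩
    have hy' : (y : K) ^ 2 = algebraMap (𝓞 K) K u := by
      simpa [ι] using congrArg Units.val hy
    obtain ⟨a, ha⟩ := IsIntegrallyClosed.exists_algebraMap_eq_of_isIntegral_pow
      (R := 𝓞 K) (x := (y : K)) two_pos (hy' ▸ isIntegral_algebraMap)
    have ha2 : a ^ 2 = u := by
      apply FaithfulSMul.algebraMap_injective (𝓞 K) K
      rw [map_pow, ha, hy']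
    have hu : IsUnit a := (isUnit_pow_iff two_ne_zero).1 (ha2 ▸ u.isUnit)
    exact ⟨hu.unit, Units.ext ha2⟩
  · rintro ⟨y, rfl⟩
    exact ⟨ι y, by simp⟩

theorem card_classGroup_two_torsion_mul_dvd :
    Nat.card (powMonoidHom 2 : ClassGroup (𝓞 K) →* ClassGroup (𝓞 K)).ker *
      2 ^ (Units.rank K + 1) ∣ (sqSubgroup Kˣ).relIndex (selmerTwo K) := by
  rw [selmerTwo, relIndex_sqSubgroup_comap _ (fractionalIdeal_sq_injective K),
    relIndex_sqSubgroup_ker_toPrincipalIdeal, mul_comm]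
  have e : Nat.card (powMonoidHom 2 : ClassGroup (𝓞 K) →* ClassGroup (𝓞 K)).ker =
      Nat.card (powMonoidHom 2 : (FractionalIdeal (𝓞 K)⁰ K)ˣ ⧸ (toPrincipalIdeal (𝓞 K) K).range →*
        (FractionalIdeal (𝓞 K)⁰ K)ˣ ⧸ (toPrincipalIdeal (𝓞 K) K).range).ker := by
    refine Nat.card_congr ((ClassGroup.equiv K).toEquiv.subtypeEquiv fun c => ?_)
    simp only [MonoidHom.mem_ker, powMonoidHom_apply, MulEquiv.toEquiv_eq_coe, EquivLike.coe_coe,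
      ← map_pow, EmbeddingLike.map_eq_one_iff]
  rw [e]
  exact mul_dvd_mul_right (two_pow_dvd_index_sqSubgroup_units K) _

end Selmer

section SelmerMembership

open NumberField IsDedekindDomain
open scoped nonZeroDivisors

variable {K : Type*} [Field K] [NumberField K]

theorem mem_selmerTwo {x : Kˣ} :
    x ∈ selmerTwo K ↔ ∃ I : (FractionalIdeal (𝓞 K)⁰ K)ˣ,
      (I : FractionalIdeal (𝓞 K)⁰ K) ^ 2 = FractionalIdeal.spanSingleton (𝓞 K)⁰ (x : K) := by
  constructor
  · rintro ⟨I, hI⟩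
    refine ⟨I, ?_⟩
    rw [← coe_toPrincipalIdeal, ← hI]
    simp
  · rintro ⟨I, hI⟩
    refine ⟨I, Units.ext ?_⟩
    rw [coe_toPrincipalIdeal, ← hI]
    simp

theorem exists_of_mem_selmerTwo {x : Kˣ} (hx : x ∈ selmerTwo K) :
    ∃ (a m : 𝓞 K) (J : Ideal (𝓞 K)), m ≠ 0 ∧ algebraMap (𝓞 K) K a = x * algebraMap (𝓞 K) K m ^ 2 ∧
      Ideal.span {a} = J ^ 2 := by
  obtain ⟨I, hI⟩ := mem_selmerTwo.1 hx
  obtain ⟨m, J, hm, hIJ⟩ := FractionalIdeal.exists_eq_spanSingleton_mul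
    (I : FractionalIdeal (𝓞 K)⁰ K)
  have hmK : algebraMap (𝓞 K) K m ≠ 0 := by simpa using hm
  have h1 : FractionalIdeal.spanSingleton (𝓞 K)⁰ ((x : K) * algebraMap (𝓞 K) K m ^ 2) =
      ((J ^ 2 : Ideal (𝓞 K)) : FractionalIdeal (𝓞 K)⁰ K) := by
    rw [← FractionalIdeal.spanSingleton_mul_spanSingleton, ← hI, hIJ, mul_pow,
      FractionalIdeal.spanSingleton_pow, mul_right_comm,
      FractionalIdeal.spanSingleton_mul_spanSingleton, ← mul_pow, inv_mul_cancel₀ hmK, one_pow,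
      FractionalIdeal.spanSingleton_one, one_mul, FractionalIdeal.coeIdeal_pow]
  have h2 := FractionalIdeal.mem_spanSingleton_self (𝓞 K)⁰ ((x : K) * algebraMap (𝓞 K) K m ^ 2)
  rw [h1, FractionalIdeal.mem_coeIdeal] at h2
  obtain ⟨a, -, ha⟩ := h2
  refine ⟨a, m, J, hm, ha, ?_⟩
  rw [← ha, ← FractionalIdeal.coeIdeal_span_singleton] at h1
  exact FractionalIdeal.coeIdeal_injective h1

theorem mem_selmerTwo_of_eq {x : Kˣ} {a m : 𝓞 K} {J : Ideal (𝓞 K)} (hm : m ≠ 0)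
    (ha : algebraMap (𝓞 K) K a = x * algebraMap (𝓞 K) K m ^ 2) (hJ : Ideal.span {a} = J ^ 2) :
    x ∈ selmerTwo K := by
  have hmK : algebraMap (𝓞 K) K m ≠ 0 := by simpa using hm
  have ha0 : a ≠ 0 := by
    rintro rfl
    rw [map_zero] at ha
    exact mul_ne_zero x.ne_zero (pow_ne_zero 2 hmK) ha.symm
  have hJ0 : J ≠ 0 := by
    rintro rfl
    rw [zero_pow two_ne_zero, Ideal.zero_eq_bot, Ideal.span_singleton_eq_bot] at hJ
    exact ha0 hJ
  have hI : FractionalIdeal.spanSingleton (𝓞 K)⁰ (algebraMap (𝓞 K) K m)⁻¹ *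
      (J : FractionalIdeal (𝓞 K)⁰ K) ≠ 0 :=
    mul_ne_zero (FractionalIdeal.spanSingleton_ne_zero_iff.2 (inv_ne_zero hmK))
      (FractionalIdeal.coeIdeal_ne_zero.2 hJ0)
  refine mem_selmerTwo.2 ⟨Units.mk0 _ hI, ?_⟩
  rw [Units.val_mk0, mul_pow, ← FractionalIdeal.coeIdeal_pow, ← hJ,
    FractionalIdeal.coeIdeal_span_singleton, ha, FractionalIdeal.spanSingleton_pow,
    FractionalIdeal.spanSingleton_mul_spanSingleton, mul_left_comm, ← mul_pow,
    inv_mul_cancel₀ hmK, one_pow, mul_one]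

theorem valuation_eq_exp_neg_count (v : HeightOneSpectrum (𝓞 K)) (x : Kˣ) :
    v.valuation K (x : K) =
      WithZero.exp (-(FractionalIdeal.count K v (FractionalIdeal.spanSingleton (𝓞 K)⁰ (x : K)))) := by
  have key : ∀ a : 𝓞 K, a ≠ 0 → v.valuation K (algebraMap (𝓞 K) K a) = WithZero.exp
      (-(FractionalIdeal.count K v (FractionalIdeal.spanSingleton (𝓞 K)⁰ (algebraMap (𝓞 K) K a)))) := by
    intro a ha
    rw [HeightOneSpectrum.valuation_of_algebraMap, v.intValuation_if_neg ha,
      ← FractionalIdeal.coeIdeal_span_singleton, FractionalIdeal.count_coe K v (by simpa using ha)]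
  obtain ⟨a, b, hb, hx⟩ := IsFractionRing.div_surjective (A := 𝓞 K) (x : K)
  have hb0 : b ≠ 0 := nonZeroDivisors.ne_zero hb
  have hbK : algebraMap (𝓞 K) K b ≠ 0 := by simpa using hb0
  have ha0 : a ≠ 0 := by
    rintro rfl
    rw [map_zero, zero_div] at hx
    exact x.ne_zero hx.symm
  have haK : algebraMap (𝓞 K) K a ≠ 0 := by simpa using ha0
  rw [← hx, map_div₀, key a ha0, key b hb0, div_eq_mul_inv (algebraMap (𝓞 K) K a),
    ← FractionalIdeal.spanSingleton_mul_spanSingleton, ← FractionalIdeal.spanSingleton_inv,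
    FractionalIdeal.count_mul K v (FractionalIdeal.spanSingleton_ne_zero_iff.2 haK)
      (inv_ne_zero (FractionalIdeal.spanSingleton_ne_zero_iff.2 hbK)),
    FractionalIdeal.count_inv, ← WithZero.exp_sub]
  congr 1
  ring

theorem isSquare_valuation_iff (v : HeightOneSpectrum (𝓞 K)) (x : Kˣ) :
    IsSquare (v.valuation K (x : K)) ↔
      Even (FractionalIdeal.count K v (FractionalIdeal.spanSingleton (𝓞 K)⁰ (x : K))) := by
  rw [valuation_eq_exp_neg_count]
  constructor
  · rintro ⟨z, hz⟩
    have hz0 : z ≠ 0 := by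
      rintro rfl
      simp at hz
    rw [← WithZero.exp_log hz0, ← WithZero.exp_add, WithZero.exp_inj] at hz
    exact ⟨-WithZero.log z, by linarith⟩
  · rintro ⟨k, hk⟩
    exact ⟨WithZero.exp (-k), by rw [hk, ← WithZero.exp_add]; congr 1; ring⟩

theorem mem_selmerTwo_iff {x : Kˣ} :
    x ∈ selmerTwo K ↔ ∀ v : HeightOneSpectrum (𝓞 K), IsSquare (v.valuation K (x : K)) := by
  have hx0 : FractionalIdeal.spanSingleton (𝓞 K)⁰ (x : K) ≠ 0 :=
    FractionalIdeal.spanSingleton_ne_zero_iff.2 x.ne_zero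
  simp_rw [isSquare_valuation_iff]
  constructor
  · intro hx v
    obtain ⟨I, hI⟩ := mem_selmerTwo.1 hx
    rw [← hI, FractionalIdeal.count_pow]
    exact ⟨_, by push_cast; ring⟩
  · intro h
    choose k hk using h
    set I := FractionalIdeal.spanSingleton (𝓞 K)⁰ (x : K) with hIdef
    have hfin : (Function.mulSupport fun v : HeightOneSpectrum (𝓞 K) =>
        (v.asIdeal : FractionalIdeal (𝓞 K)⁰ K) ^ k v).Finite := by
      refine (Filter.eventually_cofinite.1 (FractionalIdeal.finite_factors I)).subset fun v hv => ?_
      intro h0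
      apply hv
      have : k v = 0 := by have := hk v; omega
      simp [this]
    have hsq : (∏ᶠ v : HeightOneSpectrum (𝓞 K),
        (v.asIdeal : FractionalIdeal (𝓞 K)⁰ K) ^ k v) ^ 2 = I := by
      rw [finprod_pow hfin, ← FractionalIdeal.finprod_heightOneSpectrum_factorization' K hx0]
      refine finprod_congr fun v => ?_
      rw [hk v, ← zpow_natCast, ← zpow_mul]
      congr 1
      push_cast
      ring
    have hne : (∏ᶠ v : HeightOneSpectrum (𝓞 K),
        (v.asIdeal : FractionalIdeal (𝓞 K)⁰ K) ^ k v) ≠ 0 := by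
      intro h0
      rw [h0, zero_pow two_ne_zero] at hsq
      exact hx0 hsq.symm
    exact mem_selmerTwo.2 ⟨Units.mk0 _ hne, hsq⟩

theorem sqSubgroup_le_selmerTwo : sqSubgroup Kˣ ≤ selmerTwo K := by
  rintro _ ⟨y, rfl⟩
  refine mem_selmerTwo_iff.2 fun v => ⟨v.valuation K (y : K), ?_⟩
  rw [powMonoidHom_apply, Units.val_pow_eq_pow_val, map_pow, sq]

/-- The elements with even valuation at all primes outside `S`. -/
noncomputable def selmerTwoOutside (S : Finset (HeightOneSpectrum (𝓞 K))) : Subgroup Kˣ where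
  carrier := {x | ∀ v ∉ S, IsSquare (v.valuation K (x : K))}
  one_mem' := fun v _ => by simp
  mul_mem' := fun {x y} hx hy v hv => by
    rw [Units.val_mul, map_mul]
    exact (hx v hv).mul (hy v hv)
  inv_mem' := fun {x} hx v hv => by
    obtain ⟨z, hz⟩ := hx v hv
    exact ⟨z⁻¹, by rw [Units.val_inv_eq_inv_val, map_inv₀, hz, mul_inv]⟩

theorem relIndex_selmerTwoOutside (S : Finset (HeightOneSpectrum (𝓞 K))) :
    (selmerTwo K).relIndex (selmerTwoOutside S) ∣ 2 ^ S.card := by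
  classical
  let ψ : Kˣ →* Multiplicative (S → ZMod 2) :=
    { toFun := fun x => Multiplicative.ofAdd fun v =>
        ((FractionalIdeal.count K v.1 (FractionalIdeal.spanSingleton (𝓞 K)⁰ (x : K)) : ℤ) : ZMod 2)
      map_one' := by
        rw [← ofAdd_zero]
        congr 1
        funext v
        rw [Units.val_one, FractionalIdeal.spanSingleton_one, FractionalIdeal.count_one]
        simp
      map_mul' := fun x y => by
        rw [← ofAdd_add]
        congr 1
        funext v
        rw [Units.val_mul, ← FractionalIdeal.spanSingleton_mul_spanSingleton,
          FractionalIdeal.count_mul K v.1 (FractionalIdeal.spanSingleton_ne_zero_iff.2 x.ne_zero)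
            (FractionalIdeal.spanSingleton_ne_zero_iff.2 y.ne_zero)]
        simp }
  have hinf : selmerTwo K = selmerTwoOutside S ⊓ ψ.ker := by
    ext x
    rw [mem_selmerTwo_iff, Subgroup.mem_inf]
    have hψ : x ∈ ψ.ker ↔ ∀ v ∈ S, IsSquare (v.valuation K (x : K)) := by
      simp_rw [isSquare_valuation_iff, ← ZMod.intCast_eq_zero_iff_even]
      constructor
      · intro h v hv
        exact congrFun (congrArg Multiplicative.toAdd (h : ψ x = 1)) ⟨v, hv⟩
      · intro h
        apply Multiplicative.toAdd.injective
        funext v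
        exact h v.1 v.2
    rw [hψ]
    exact ⟨fun h => ⟨fun v _ => h v, fun v _ => h v⟩, fun h v => by
      by_cases hv : v ∈ S
      · exact h.2 v hv
      · exact h.1 v hv⟩
  rw [hinf, Subgroup.inf_relIndex_left, Subgroup.relIndex_ker]
  have := Subgroup.card_subgroup_dvd_card ((selmerTwoOutside S).map ψ)
  rwa [Nat.card_eq_fintype_card (α := Multiplicative (S → ZMod 2)), Fintype.card_multiplicative,
    Fintype.card_fun, ZMod.card, Fintype.card_coe] at this

end SelmerMembership

section Quadratic

open NumberField IsDedekindDomain Module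

variable {F L : Type*} [Field F] [Field L] [Algebra F L]

theorem sq_sub_trace_mul_add_norm_eq_zero (h2 : finrank F L = 2) (x : L) :
    x ^ 2 - algebraMap F L (Algebra.trace F L x) * x + algebraMap F L (Algebra.norm F x) = 0 := by
  have : FiniteDimensional F L := .of_finrank_pos (by omega)
  let b : Basis (Fin 2) F L := finBasisOfFinrankEq F L h2
  have h := Matrix.aeval_self_charpoly (Algebra.leftMulMatrix b x)
  rw [Matrix.charpoly_fin_two, Polynomial.aeval_def] at h
  have h3 : Algebra.leftMulMatrix b (x ^ 2 - algebraMap F L (Algebra.trace F L x) * x +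
      algebraMap F L (Algebra.norm F x)) = 0 := by
    rw [← h, Algebra.trace_eq_matrix_trace b, Algebra.norm_eq_matrix_det b]
    simp
  exact (Algebra.leftMulMatrix_injective b) (h3.trans (map_zero _).symm)

theorem exists_eq_mul_sq_of_norm_eq_sq (h2 : finrank F L = 2) {x : Lˣ} {b : Fˣ}
    (hx : Algebra.norm F (x : L) = (b : F) ^ 2) :
    ∃ (c : Fˣ) (y : Lˣ), (x : L) = algebraMap F L c * (y : L) ^ 2 := by
  have hb : algebraMap F L b ≠ 0 := by simp
  set t := Algebra.trace F L (x : L)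
  have h := sq_sub_trace_mul_add_norm_eq_zero h2 (x : L)
  rw [hx, map_pow] at h
  have key : ((x : L) + algebraMap F L b) ^ 2 = algebraMap F L (t + 2 * b) * x := by
    rw [map_add, map_mul, map_ofNat]
    linear_combination h
  by_cases ht : t + 2 * b = 0
  · refine ⟨-b, 1, ?_⟩
    rw [ht, map_zero, zero_mul, sq_eq_zero_iff] at key
    rw [Units.val_neg, map_neg, Units.val_one, one_pow, mul_one]
    linear_combination key
  · have ht' : algebraMap F L (t + 2 * b) ≠ 0 := (map_ne_zero _).2 ht
    have hy : (x : L) + algebraMap F L b ≠ 0 := by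
      intro h0
      rw [h0, zero_pow two_ne_zero] at key
      exact mul_ne_zero ht' x.ne_zero key.symm
    refine ⟨Units.mk0 _ ht, Units.mk0 _ (div_ne_zero hy ht'), ?_⟩
    rw [Units.val_mk0, Units.val_mk0, div_pow, key]
    field_simp

variable [NumberField F] [NumberField L]

theorem norm_mem_selmerTwo {x : Lˣ} (hx : x ∈ selmerTwo L) :
    Units.map (Algebra.norm F) x ∈ selmerTwo F := by
  obtain ⟨a, m, J, hm, ha, hJ⟩ := exists_of_mem_selmerTwo hx
  refine mem_selmerTwo_of_eq (a := Algebra.intNorm (𝓞 F) (𝓞 L) a)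
    (m := Algebra.intNorm (𝓞 F) (𝓞 L) m) (J := Ideal.relNorm (𝓞 F) J)
    (Algebra.intNorm_ne_zero.2 hm) ?_ ?_
  · rw [Algebra.algebraMap_intNorm (A := 𝓞 F) (K := F) (L := L) (B := 𝓞 L),
      Algebra.algebraMap_intNorm (A := 𝓞 F) (K := F) (L := L) (B := 𝓞 L), ha, map_mul, map_pow]
    rfl
  · rw [← Ideal.relNorm_singleton, hJ, map_pow]

theorem isSquare_valuation_of_unramified (h2 : finrank F L = 2) {θ : 𝓞 L} {t n : 𝓞 F}
    (hθ : θ ^ 2 - algebraMap (𝓞 F) (𝓞 L) t * θ + algebraMap (𝓞 F) (𝓞 L) n = 0)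
    (hd : ∀ z : F, z ^ 2 ≠ algebraMap (𝓞 F) F (t ^ 2 - 4 * n))
    {v : HeightOneSpectrum (𝓞 F)} (hv : t ^ 2 - 4 * n ∉ v.asIdeal) {x : F}
    (hx : ∀ w : HeightOneSpectrum (𝓞 L), IsSquare (w.valuation L (algebraMap F L x))) :
    IsSquare (v.valuation F x) := by
  have : FiniteDimensional F L := .of_finrank_pos (by omega)
  have hθF : (algebraMap (𝓞 L) L θ) ∉ (algebraMap F L).range := by
    rintro ⟨c, hc⟩
    apply hd (2 * c - algebraMap (𝓞 F) F t)
    apply (algebraMap F L).injective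
    have h := congrArg (algebraMap (𝓞 L) L) hθ
    simp only [map_add, map_sub, map_mul, map_pow, map_zero, ← hc,
      ← IsScalarTower.algebraMap_apply (𝓞 F) (𝓞 L) L] at h
    simp only [map_sub, map_mul, map_pow, map_ofNat,
      ← IsScalarTower.algebraMap_apply (𝓞 F) F L]
    linear_combination 4 * h
  have hadj : Algebra.adjoin F {algebraMap (𝓞 L) L θ} = ⊤ := by
    have hint : IsIntegral F (algebraMap (𝓞 L) L θ) := Algebra.IsIntegral.isIntegral _
    have h1 : IntermediateField.adjoin F {algebraMap (𝓞 L) L θ} = ⊤ := by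
      have hp : (finrank F L).Prime := h2 ▸ Nat.prime_two
      have := Subalgebra.isSimpleOrder_of_finrank_prime F L hp
      have := IntermediateField.isSimpleOrder_of_finrank_prime F L hp
      refine (eq_bot_or_eq_top _).resolve_left fun hbot => hθF ?_
      exact IntermediateField.mem_bot.1 (IntermediateField.adjoin_simple_eq_bot_iff.1 hbot)
    rw [← IntermediateField.adjoin_simple_toSubalgebra_of_isAlgebraic hint.isAlgebraic, h1,
      IntermediateField.top_toSubalgebra]
  obtain ⟨w, hw⟩ : ∃ w : HeightOneSpectrum (𝓞 L), w.asIdeal.LiesOver v.asIdeal := by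
    obtain ⟨Q, hQ, hQv⟩ := Ideal.exists_maximal_ideal_liesOver_of_isIntegral (S := 𝓞 L) v.asIdeal
    exact ⟨⟨Q, hQ.isPrime, Ideal.ne_bot_of_liesOver_of_ne_bot v.ne_bot Q⟩, hQv⟩
  have hf : minpoly (𝓞 F) θ =
      Polynomial.X ^ 2 - Polynomial.C t * Polynomial.X + Polynomial.C n := by
    have hint : IsIntegral (𝓞 F) θ := Algebra.IsIntegral.isIntegral _
    have hdeg : (Polynomial.X ^ 2 - Polynomial.C t * Polynomial.X +
        Polynomial.C n : Polynomial (𝓞 F)).natDegree = 2 := by compute_degree!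
    refine (Polynomial.eq_of_monic_of_dvd_of_natDegree_le (minpoly.monic hint) ?_ ?_ ?_).symm
    · monicity!
    · apply minpoly.isIntegrallyClosed_dvd hint
      simpa using hθ
    · rw [hdeg]
      refine (minpoly.two_le_natDegree_iff hint).2 ?_
      rintro ⟨c, hc⟩
      exact hθF ⟨algebraMap (𝓞 F) F c, by
        rw [← hc, ← IsScalarTower.algebraMap_apply, ← IsScalarTower.algebraMap_apply]⟩
  have hD := aeval_derivative_mem_differentIdeal (𝓞 F) F L θ hadj
  rw [hf] at hD
  simp only [Polynomial.derivative_X_pow,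
    Polynomial.derivative_C_mul, Polynomial.derivative_X, Polynomial.derivative_C, map_add, map_sub,
    map_mul, Polynomial.aeval_X, Polynomial.aeval_C,
    mul_one, add_zero, Nat.cast_ofNat, Nat.add_one_sub_one, pow_one] at hD
  have hnd : ¬ w.asIdeal ∣ differentIdeal (𝓞 F) (𝓞 L) := fun h => by
    apply hv
    have h1 := w.asIdeal.mul_mem_left (2 * θ - algebraMap (𝓞 F) (𝓞 L) t)
      ((Ideal.dvd_iff_le.1 h) hD)
    rw [hw.over, Ideal.mem_comap]
    convert h1 using 1
    simp only [map_sub, map_mul, map_pow, map_ofNat]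
    linear_combination -4 * hθ
  have := w.isPrime
  have hunr := not_dvd_differentIdeal_iff.1 hnd
  have he : w.asIdeal.ramificationIdx (𝓞 F) = 1 := Ideal.ramificationIdx_eq_one_of_isUnramifiedAt
  have he' : v.asIdeal.ramificationIdx' w.asIdeal = 1 :=
    (Ideal.ramificationIdx'_eq_ramificationIdx v.asIdeal w.asIdeal v.ne_bot).trans he
  have := HeightOneSpectrum.valuation_liesOver (K := F) L v w x
  rw [he', pow_one] at this
  rw [this]
  exact hx w

end Quadratic

section QuadraticStep

open NumberField IsDedekindDomain Module

variable {F L : Type*} [Field F] [Field L] [Algebra F L] [NumberField F] [NumberField L]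

/-- Passing from `F` to a quadratic extension `L = F(θ)`: the size of `selmerTwo` modulo squares
at most doubles exponentially, up to the primes in `S` dividing the discriminant of `θ`. -/
theorem two_mul_relIndex_selmerTwo_dvd_of_index (h2 : finrank F L = 2) {θ : 𝓞 L} {t n : 𝓞 F}
    (hθ : θ ^ 2 - algebraMap (𝓞 F) (𝓞 L) t * θ + algebraMap (𝓞 F) (𝓞 L) n = 0)
    (hd : ∀ z : F, z ^ 2 ≠ algebraMap (𝓞 F) F (t ^ 2 - 4 * n))
    {S : Finset (HeightOneSpectrum (𝓞 F))}
    (hS : ∀ v : HeightOneSpectrum (𝓞 F), t ^ 2 - 4 * n ∈ v.asIdeal → v ∈ S) {m : ℕ}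
    (hm : m * (sqSubgroup Fˣ).relIndex ((selmerTwo L).map (Units.map (Algebra.norm F)) ⊔
      sqSubgroup Fˣ) ∣ (sqSubgroup Fˣ).relIndex (selmerTwo F)) :
    2 * m * (sqSubgroup Lˣ).relIndex (selmerTwo L) ∣
      (sqSubgroup Fˣ).relIndex (selmerTwo F) ^ 2 * 2 ^ S.card := by
  set N : Lˣ →* Fˣ := Units.map (Algebra.norm F)
  let j : Fˣ →* Lˣ := Units.map (algebraMap F L : F →* L)
  set A : Subgroup Lˣ := selmerTwo L ⊓ (sqSubgroup Fˣ).comap N with hA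
  have hsqA : sqSubgroup Lˣ ≤ A := by
    refine le_inf sqSubgroup_le_selmerTwo ?_
    rintro _ ⟨y, rfl⟩
    exact ⟨N y, by simp⟩
  have h1 : m * A.relIndex (selmerTwo L) ∣ (sqSubgroup Fˣ).relIndex (selmerTwo F) := by
    rwa [hA, Subgroup.inf_relIndex_left, Subgroup.relIndex_comap, ← Subgroup.relIndex_sup_right]
  set Q : Subgroup Fˣ := (sqSubgroup Lˣ).comap j
  set D : Subgroup Fˣ := (selmerTwo L).comap j
  have hQD : Q ≤ D := Subgroup.comap_mono sqSubgroup_le_selmerTwo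
  have hsqQ : sqSubgroup Fˣ ≤ Q := by
    rintro _ ⟨y, rfl⟩
    exact ⟨j y, by simp⟩
  have hDS : D ≤ selmerTwoOutside S := fun x hx v hv =>
    isSquare_valuation_of_unramified h2 hθ hd (fun h => hv (hS v h))
      (fun w => mem_selmerTwo_iff.1 hx w)
  have hAD : A ≤ D.map j ⊔ sqSubgroup Lˣ := by
    rintro x ⟨hx, b, hb⟩
    obtain ⟨c, y, hcy⟩ := exists_eq_mul_sq_of_norm_eq_sq h2 (x := x) (b := b)
      (by simpa [N] using (congrArg Units.val hb).symm)
    have hxc : x = j c * y ^ 2 := Units.ext (by simpa [j] using hcy)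
    have hc : c ∈ D := by
      have : j c = x * (y ^ 2)⁻¹ := by rw [hxc, mul_inv_cancel_right]
      rw [Subgroup.mem_comap, this]
      exact mul_mem hx (inv_mem (sqSubgroup_le_selmerTwo (sq_mem_sqSubgroup y)))
    rw [hxc]
    exact mul_mem (Subgroup.mem_sup_left ⟨c, hc, rfl⟩) (Subgroup.mem_sup_right (sq_mem_sqSubgroup y))
  have h3 : (sqSubgroup Lˣ).relIndex A ∣ Q.relIndex D := by
    have e : (sqSubgroup Lˣ).relIndex (D.map j) =
        (sqSubgroup Lˣ).relIndex (D.map j ⊔ sqSubgroup Lˣ) := (Subgroup.relIndex_sup_right ..).symm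
    rw [Subgroup.relIndex_comap, e, ← Subgroup.relIndex_mul_relIndex _ _ _ hsqA hAD]
    exact dvd_mul_right _ _
  have h4 : 2 ∣ (sqSubgroup Fˣ).relIndex Q := by
    have hd0 : algebraMap (𝓞 F) F (t ^ 2 - 4 * n) ≠ 0 := fun h => hd 0 (by rw [h]; simp)
    refine Subgroup.two_dvd_relIndex (fun x _ => sq_mem_sqSubgroup x)
      ⟨Units.mk0 _ hd0, ?_, ?_⟩
    · have hsq : algebraMap (𝓞 L) L (2 * θ - algebraMap (𝓞 F) (𝓞 L) t) ^ 2 =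
          algebraMap F L (algebraMap (𝓞 F) F (t ^ 2 - 4 * n)) := by
        rw [← IsScalarTower.algebraMap_apply, IsScalarTower.algebraMap_apply (𝓞 F) (𝓞 L) L,
          ← map_pow]
        congr 1
        simp only [map_sub, map_mul, map_pow, map_ofNat]
        linear_combination 4 * hθ
      have hne : algebraMap (𝓞 L) L (2 * θ - algebraMap (𝓞 F) (𝓞 L) t) ≠ 0 := fun h => by
        rw [h, zero_pow two_ne_zero] at hsq
        exact (map_ne_zero _).2 hd0 hsq.symm
      exact ⟨Units.mk0 _ hne, Units.ext (by simpa [j] using hsq)⟩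
    · rintro ⟨z, hz⟩
      exact hd z (by simpa using congrArg Units.val hz)
  have h5 : 2 * (sqSubgroup Lˣ).relIndex A ∣
      (sqSubgroup Fˣ).relIndex (selmerTwo F) * 2 ^ S.card := by
    have e1 := Subgroup.relIndex_mul_relIndex _ _ _ hsqQ hQD
    have e2 := Subgroup.relIndex_mul_relIndex _ _ _ (hsqQ.trans hQD) hDS
    have hSel : selmerTwo F ≤ selmerTwoOutside S := fun x hx v _ => mem_selmerTwo_iff.1 hx v
    have e3 := Subgroup.relIndex_mul_relIndex _ _ _ sqSubgroup_le_selmerTwo hSel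
    calc 2 * (sqSubgroup Lˣ).relIndex A ∣ (sqSubgroup Fˣ).relIndex Q * Q.relIndex D :=
          mul_dvd_mul h4 h3
      _ = (sqSubgroup Fˣ).relIndex D := e1
      _ ∣ (sqSubgroup Fˣ).relIndex (selmerTwoOutside S) := e2 ▸ dvd_mul_right _ _
      _ ∣ _ := e3 ▸ mul_dvd_mul_left _ (relIndex_selmerTwoOutside S)
  rw [← Subgroup.relIndex_mul_relIndex _ _ _ hsqA inf_le_left,
    show 2 * m * ((sqSubgroup Lˣ).relIndex A * A.relIndex (selmerTwo L)) =
      (m * A.relIndex (selmerTwo L)) * (2 * (sqSubgroup Lˣ).relIndex A) by ring, pow_two, mul_assoc ((sqSubgroup Fˣ).relIndex _)]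
  exact mul_dvd_mul h1 h5

theorem map_norm_sup_le_selmerTwo :
    (selmerTwo L).map (Units.map (Algebra.norm F)) ⊔ sqSubgroup Fˣ ≤ selmerTwo F := by
  refine sup_le ?_ sqSubgroup_le_selmerTwo
  rintro _ ⟨x, hx, rfl⟩
  exact norm_mem_selmerTwo hx

theorem two_mul_relIndex_selmerTwo_dvd (h2 : finrank F L = 2) {θ : 𝓞 L} {t n : 𝓞 F}
    (hθ : θ ^ 2 - algebraMap (𝓞 F) (𝓞 L) t * θ + algebraMap (𝓞 F) (𝓞 L) n = 0)
    (hd : ∀ z : F, z ^ 2 ≠ algebraMap (𝓞 F) F (t ^ 2 - 4 * n))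
    {S : Finset (HeightOneSpectrum (𝓞 F))}
    (hS : ∀ v : HeightOneSpectrum (𝓞 F), t ^ 2 - 4 * n ∈ v.asIdeal → v ∈ S) :
    2 * (sqSubgroup Lˣ).relIndex (selmerTwo L) ∣
      (sqSubgroup Fˣ).relIndex (selmerTwo F) ^ 2 * 2 ^ S.card := by
  have := two_mul_relIndex_selmerTwo_dvd_of_index h2 hθ hd hS (m := 1) (by
    rw [one_mul, ← Subgroup.relIndex_mul_relIndex (sqSubgroup Fˣ) _ _ le_sup_right
      (map_norm_sup_le_selmerTwo (L := L))]
    exact dvd_mul_right _ _)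
  rwa [mul_one] at this

theorem four_mul_relIndex_selmerTwo_dvd (h2 : finrank F L = 2) {θ : 𝓞 L} {t n : 𝓞 F}
    (hθ : θ ^ 2 - algebraMap (𝓞 F) (𝓞 L) t * θ + algebraMap (𝓞 F) (𝓞 L) n = 0)
    (hd : ∀ z : F, z ^ 2 ≠ algebraMap (𝓞 F) F (t ^ 2 - 4 * n))
    {S : Finset (HeightOneSpectrum (𝓞 F))}
    (hS : ∀ v : HeightOneSpectrum (𝓞 F), t ^ 2 - 4 * n ∈ v.asIdeal → v ∈ S) {s : Fˣ}
    (hs : s ∈ selmerTwo F) (hsN : ∀ (x : Lˣ) (y : Fˣ), (s : F) ≠ Algebra.norm F (x : L) * (y : F) ^ 2) :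
    4 * (sqSubgroup Lˣ).relIndex (selmerTwo L) ∣
      (sqSubgroup Fˣ).relIndex (selmerTwo F) ^ 2 * 2 ^ S.card := by
  refine two_mul_relIndex_selmerTwo_dvd_of_index h2 hθ hd hS (m := 2) ?_
  rw [← Subgroup.relIndex_mul_relIndex (sqSubgroup Fˣ) _ _ le_sup_right
      (map_norm_sup_le_selmerTwo (L := L)), mul_comm]
  refine mul_dvd_mul_left _ (Subgroup.two_dvd_relIndex
    (fun x _ => Subgroup.mem_sup_right (sq_mem_sqSubgroup x)) ⟨s, hs, fun h => ?_⟩)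
  obtain ⟨_, ⟨x, -, rfl⟩, _, ⟨y, rfl⟩, hxy⟩ := Subgroup.mem_sup.1 h
  exact hsN x y (by simpa using (congrArg Units.val hxy).symm)

end QuadraticStep

section QuadraticCoordinates

open Module

variable {F L : Type*} [Field F] [Field L] [Algebra F L]

theorem eq_zero_of_add_mul_eq_zero {d : F} (hd : ∀ z : F, z ^ 2 ≠ d) {r : L}
    (hr : r ^ 2 = algebraMap F L d) {a b : F} (h : algebraMap F L a + algebraMap F L b * r = 0) :
    a = 0 ∧ b = 0 := by
  have hb : b = 0 := by
    by_contra hb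
    apply hd (-a / b)
    apply (algebraMap F L).injective
    have hb' : algebraMap F L b ≠ 0 := (map_ne_zero _).2 hb
    rw [← hr, map_pow, map_div₀, map_neg]
    field_simp
    linear_combination (algebraMap F L a - algebraMap F L b * r) * h
  subst hb
  rw [map_zero, zero_mul, add_zero, map_eq_zero] at h
  exact ⟨h, rfl⟩

theorem eq_and_eq_of_add_mul_eq {d : F} (hd : ∀ z : F, z ^ 2 ≠ d) {r : L}
    (hr : r ^ 2 = algebraMap F L d) {a b a' b' : F}
    (h : algebraMap F L a + algebraMap F L b * r = algebraMap F L a' + algebraMap F L b' * r) :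
    a = a' ∧ b = b' := by
  have := eq_zero_of_add_mul_eq_zero hd hr (a := a - a') (b := b - b') (by
    rw [map_sub, map_sub]
    linear_combination h)
  exact ⟨sub_eq_zero.1 this.1, sub_eq_zero.1 this.2⟩

theorem exists_eq_add_mul (h2 : finrank F L = 2) {d : F} (hd : ∀ z : F, z ^ 2 ≠ d) {r : L}
    (hr : r ^ 2 = algebraMap F L d) (x : L) :
    ∃ a b : F, x = algebraMap F L a + algebraMap F L b * r := by
  have hli : LinearIndependent F ![1, r] := by
    rw [LinearIndependent.pair_iff]
    intro a b h
    apply eq_zero_of_add_mul_eq_zero hd hr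
    simpa [Algebra.smul_def] using h
  have hspan := hli.span_eq_top_of_card_eq_finrank (by simp [h2])
  have hx : x ∈ Submodule.span F (Set.range ![1, r]) := hspan ▸ Submodule.mem_top
  rw [Matrix.range_cons, Matrix.range_cons, Matrix.range_empty, Set.union_empty] at hx
  obtain ⟨a, b, hab⟩ := Submodule.mem_span_pair.1 hx
  exact ⟨a, b, by rw [← hab]; simp [Algebra.smul_def]⟩

theorem norm_add_mul (h2 : finrank F L = 2) {d : F} (hd : ∀ z : F, z ^ 2 ≠ d) {r : L}
    (hr : r ^ 2 = algebraMap F L d) (a b : F) :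
    Algebra.norm F (algebraMap F L a + algebraMap F L b * r) = a ^ 2 - d * b ^ 2 := by
  by_cases hb : b = 0
  · subst hb
    simp [Algebra.norm_algebraMap, h2]
  · set x := algebraMap F L a + algebraMap F L b * r
    have h := sq_sub_trace_mul_add_norm_eq_zero h2 x
    set t := Algebra.trace F L x
    set n := Algebra.norm F x
    have key := eq_zero_of_add_mul_eq_zero hd hr (a := a ^ 2 + d * b ^ 2 - t * a + n)
      (b := 2 * a * b - t * b) (by
        rw [← h]
        simp only [map_add, map_sub, map_mul, map_pow, map_ofNat, ← hr, x]
        ring)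
    have ht : t = 2 * a := by
      apply mul_right_cancel₀ hb
      linear_combination -key.2
    rw [ht] at key
    linear_combination key.1

theorem isSquare_or_of_isSquare_algebraMap [CharZero F] (h2 : finrank F L = 2) {d : F}
    (hd : ∀ z : F, z ^ 2 ≠ d) {r : L} (hr : r ^ 2 = algebraMap F L d) {x : F} {z : L}
    (hz : z ^ 2 = algebraMap F L x) : ∃ c : F, c ^ 2 = x ∨ c ^ 2 * d = x := by
  obtain ⟨a, b, rfl⟩ := exists_eq_add_mul h2 hd hr z
  have key := eq_and_eq_of_add_mul_eq hd hr (a := a ^ 2 + d * b ^ 2) (b := 2 * a * b) (a' := x)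
    (b' := 0) (by
      rw [map_zero, zero_mul, add_zero, ← hz]
      simp only [map_add, map_mul, map_pow, map_ofNat, ← hr]
      ring)
  rcases mul_eq_zero.1 key.2 with h | h
  · have ha : a = 0 := by simpa using h
    exact ⟨b, Or.inr (by rw [← key.1, ha]; ring)⟩
  · exact ⟨a, Or.inl (by rw [← key.1, h]; ring)⟩

theorem forall_sq_ne_algebraMap [CharZero F] (h2 : finrank F L = 2) {d : F}
    (hd : ∀ z : F, z ^ 2 ≠ d) {r : L} (hr : r ^ 2 = algebraMap F L d) {x : F}
    (h1 : ∀ z : F, z ^ 2 ≠ x) (hx : ∀ z : F, z ^ 2 ≠ x * d) (z : L) :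
    z ^ 2 ≠ algebraMap F L x := by
  intro hz
  obtain ⟨c, hc | hc⟩ := isSquare_or_of_isSquare_algebraMap h2 hd hr hz
  · exact h1 c hc
  · exact hx (c * d) (by rw [← hc]; ring)

theorem exists_ringHom_of_sq_eq (h2 : finrank F L = 2) {d : F} (hd : ∀ z : F, z ^ 2 ≠ d) {r : L}
    (hr : r ^ 2 = algebraMap F L d) {E : Type*} [Field E] [Algebra F E] {ρ : E}
    (hρ : ρ ^ 2 = algebraMap F E d) : ∃ φ : L →ₐ[F] E, φ r = ρ := by
  choose a b hab using exists_eq_add_mul h2 hd hr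
  have uniq : ∀ {x y : F} {z : L}, z = algebraMap F L x + algebraMap F L y * r →
      a z = x ∧ b z = y := fun h => eq_and_eq_of_add_mul_eq hd hr ((hab _).symm.trans h)
  refine ⟨AlgHom.ofLinearMap
    { toFun := fun z => algebraMap F E (a z) + algebraMap F E (b z) * ρ
      map_add' := fun x y => ?_
      map_smul' := fun c x => ?_ } ?_ ?_, ?_⟩
  · obtain ⟨h1, h2⟩ := uniq (z := x + y) (x := a x + a y) (y := b x + b y) (by
      conv_lhs => rw [hab x, hab y]
      simp only [map_add]
      ring)
    rw [h1, h2, map_add, map_add]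
    ring
  · obtain ⟨h1, h2⟩ := uniq (z := c • x) (x := c * a x) (y := c * b x) (by
      conv_lhs => rw [hab x]
      simp only [map_mul, Algebra.smul_def]
      ring)
    rw [h1, h2, map_mul, map_mul, Algebra.smul_def, RingHom.id_apply]
    ring
  · obtain ⟨h1, h2⟩ := uniq (z := 1) (x := 1) (y := 0) (by simp)
    simp [h1, h2]
  · intro x y
    obtain ⟨h1, h2⟩ := uniq (z := x * y) (x := a x * a y + d * (b x * b y))
      (y := a x * b y + b x * a y) (by
      conv_lhs => rw [hab x, hab y]
      simp only [map_add, map_mul, ← hr]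
      ring)
    simp only [LinearMap.coe_mk, AddHom.coe_mk, h1, h2, map_add, map_mul, ← hρ]
    ring
  · obtain ⟨h1, h2⟩ := uniq (z := r) (x := 0) (y := 1) (by simp)
    simp [h1, h2]

end QuadraticCoordinates

section RationalBase

open NumberField IsDedekindDomain Module

theorem card_units_ringOfIntegers_rat : Nat.card (𝓞 ℚ)ˣ = 2 := by
  rw [Nat.card_congr (Units.mapEquiv Rat.ringOfIntegersEquiv.toMulEquiv).toEquiv,
    Nat.card_eq_fintype_card, Fintype.card_units_int]

theorem relIndex_selmerTwo_rat : (sqSubgroup ℚˣ).relIndex (selmerTwo ℚ) ∣ 2 := by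
  have h1 : Nat.card (powMonoidHom 2 : (FractionalIdeal (nonZeroDivisors (𝓞 ℚ)) ℚ)ˣ ⧸
      (toPrincipalIdeal (𝓞 ℚ) ℚ).range →* _ ⧸ _).ker = 1 := by
    have h : Nat.card (ClassGroup (𝓞 ℚ)) = 1 := by
      rw [Nat.card_eq_fintype_card]
      exact Rat.classNumber_eq
    rw [Nat.card_congr (ClassGroup.equiv ℚ).toEquiv] at h
    have := (Nat.card_eq_one_iff_unique.1 h).1
    exact Nat.card_unique
  rw [selmerTwo, relIndex_sqSubgroup_comap _ (fractionalIdeal_sq_injective ℚ),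
    relIndex_sqSubgroup_ker_toPrincipalIdeal, h1, mul_one, ← card_units_ringOfIntegers_rat]
  exact Subgroup.index_dvd_card _

theorem neg_one_mem_selmerTwo {K : Type*} [Field K] [NumberField K] : (-1 : Kˣ) ∈ selmerTwo K :=
  mem_selmerTwo_of_eq (a := -1) (m := 1) (J := 1) one_ne_zero (by simp) (by
    rw [one_pow, Ideal.one_eq_top, Ideal.span_singleton_eq_top]
    exact isUnit_one.neg)

theorem neg_one_ne_norm_mul_sq {L : Type*} [Field L] [NumberField L] (h2 : finrank ℚ L = 2) {d : ℚ}
    (hd : d < 0) {r : L} (hr : r ^ 2 = algebraMap ℚ L d) (x : Lˣ) (y : ℚˣ) :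
    ((-1 : ℚˣ) : ℚ) ≠ Algebra.norm ℚ (x : L) * (y : ℚ) ^ 2 := by
  obtain ⟨a, b, hab⟩ := exists_eq_add_mul h2 (fun z hz => by nlinarith [sq_nonneg z]) hr (x : L)
  rw [hab, norm_add_mul h2 (fun z hz => by nlinarith [sq_nonneg z]) hr, Units.val_neg,
    Units.val_one]
  intro h
  have : 0 ≤ (a ^ 2 - d * b ^ 2) * (y : ℚ) ^ 2 :=
    mul_nonneg (by nlinarith [sq_nonneg a, sq_nonneg b]) (sq_nonneg _)
  linarith

end RationalBase

section PadicReduction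

theorem Padic.exists_scaling {ℓ : ℕ} [Fact ℓ.Prime] {ι : Type*} [Finite ι] (f : ι → ℚ_[ℓ])
    {i₀ : ι} (h : f i₀ ≠ 0) :
    ∃ (k : ℚ_[ℓ]) (g : ι → ℤ_[ℓ]), k ≠ 0 ∧ (∀ i, (g i : ℚ_[ℓ]) = k * f i) ∧
      ∃ i, PadicInt.toZMod (g i) ≠ 0 := by
  have : Nonempty ι := ⟨i₀⟩
  obtain ⟨i, hi⟩ := Finite.exists_max fun i => ‖f i‖
  have hfi : f i ≠ 0 := fun h0 => h (norm_le_zero_iff.1 ((hi i₀).trans (by simp [h0])))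
  refine ⟨(f i)⁻¹, fun j => ⟨(f i)⁻¹ * f j, ?_⟩, inv_ne_zero hfi, fun j => rfl, i, ?_⟩
  · rw [norm_mul, norm_inv, inv_mul_le_one₀ (norm_pos_iff.2 hfi)]
    exact hi j
  · intro h
    refine one_ne_zero (α := ZMod ℓ) ?_
    rw [← h, ← map_one PadicInt.toZMod]
    congr 1
    exact Subtype.ext (PadicInt.coe_one.trans (inv_mul_cancel₀ hfi).symm)

theorem eq_zero_of_sq_sub_mul_sq_eq_zero {k : Type*} [Field k] {d x y : k} (hd : ¬ IsSquare d)
    (h : x ^ 2 - d * y ^ 2 = 0) : x = 0 ∧ y = 0 := by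
  have hy : y = 0 := by
    by_contra hy
    exact hd ⟨x / y, by field_simp; linear_combination -h⟩
  subst hy
  exact ⟨by simpa using h, rfl⟩

theorem PadicInt.toZMod_eq_zero_iff_dvd {ℓ : ℕ} [Fact ℓ.Prime] (x : ℤ_[ℓ]) :
    PadicInt.toZMod x = 0 ↔ (ℓ : ℤ_[ℓ]) ∣ x := by
  rw [← RingHom.mem_ker, PadicInt.ker_toZMod, PadicInt.maximalIdeal_eq_span_p,
    Ideal.mem_span_singleton]

/-- The coordinates of `(b + √p) c² = x² + q y²` over `ℚ_q`, where `p = a² + b²` is a nonresidue. -/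
theorem Padic.eq_zero_of_twisted_norm_eq {p q : ℕ} [Fact q.Prime] (hq : q % 4 = 3) {a b : ℤ}
    (hab : (p : ℤ) = a ^ 2 + b ^ 2) (hp : ¬ IsSquare (p : ZMod q)) {c₁ c₂ x₁ x₂ y₁ y₂ : ℚ_[q]}
    (h1 : b * (c₁ ^ 2 + p * c₂ ^ 2) + 2 * p * c₁ * c₂ =
      x₁ ^ 2 + p * x₂ ^ 2 + q * (y₁ ^ 2 + p * y₂ ^ 2))
    (h2 : c₁ ^ 2 + p * c₂ ^ 2 + 2 * b * c₁ * c₂ = 2 * x₁ * x₂ + 2 * q * y₁ * y₂) :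
    c₁ = 0 ∧ c₂ = 0 := by
  by_contra hcon
  set f : Fin 6 → ℚ_[q] := ![c₁, c₂, x₁, x₂, y₁, y₂] with hf
  obtain ⟨i₀, hi₀⟩ : ∃ i, f i ≠ 0 := by
    rw [not_and_or] at hcon
    rcases hcon with h | h
    exacts [⟨0, h⟩, ⟨1, h⟩]
  obtain ⟨k, g, hk, hg, i, hi⟩ := Padic.exists_scaling f hi₀
  have hab' : ((p : ℤ) : ZMod q) = ((a ^ 2 + b ^ 2 : ℤ) : ZMod q) := by rw [hab]
  push_cast at hab'
  have ha : (a : ZMod q) ≠ 0 := fun h => hp ⟨b, by rw [hab', h]; ring⟩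
  have hneg : ¬ IsSquare (-1 : ZMod q) := fun h => ZMod.exists_sq_eq_neg_one_iff.1 h hq
  have h2c : ((2 : ℤ_[q]) : ℚ_[q]) = 2 := map_ofNat PadicInt.Coe.ringHom 2
  have E1 : (b : ℤ_[q]) * (g 0 ^ 2 + p * g 1 ^ 2) + 2 * p * g 0 * g 1 =
      g 2 ^ 2 + p * g 3 ^ 2 + q * (g 4 ^ 2 + p * g 5 ^ 2) := by
    apply Subtype.coe_injective
    push_cast
    rw [h2c, hg, hg, hg, hg, hg, hg]
    simp only [hf, Matrix.cons_val]
    linear_combination k ^ 2 * h1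
  have E2 : g 0 ^ 2 + p * g 1 ^ 2 + 2 * (b : ℤ_[q]) * g 0 * g 1 =
      2 * g 2 * g 3 + 2 * q * g 4 * g 5 := by
    apply Subtype.coe_injective
    push_cast
    rw [h2c, hg, hg, hg, hg, hg, hg]
    simp only [hf, Matrix.cons_val]
    linear_combination k ^ 2 * h2
  have R1 := congrArg PadicInt.toZMod E1
  have R2 := congrArg PadicInt.toZMod E2
  simp only [map_add, map_mul, map_pow, map_intCast, map_natCast, map_ofNat, CharP.cast_eq_zero,
    mul_zero, zero_mul, add_zero] at R1 R2
  have hN : -(a : ZMod q) ^ 2 * (PadicInt.toZMod (g 0) ^ 2 - p * PadicInt.toZMod (g 1) ^ 2) ^ 2 =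
      (PadicInt.toZMod (g 2) ^ 2 - p * PadicInt.toZMod (g 3) ^ 2) ^ 2 := by
    have e1 : -(a : ZMod q) ^ 2 = (b : ZMod q) ^ 2 - p := by rw [hab']; ring
    rw [e1]
    linear_combination (b * (PadicInt.toZMod (g 0) ^ 2 + p * PadicInt.toZMod (g 1) ^ 2) +
      2 * p * PadicInt.toZMod (g 0) * PadicInt.toZMod (g 1) +
      (PadicInt.toZMod (g 2) ^ 2 + p * PadicInt.toZMod (g 3) ^ 2)) * R1 -
      p * (PadicInt.toZMod (g 0) ^ 2 + p * PadicInt.toZMod (g 1) ^ 2 +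
        2 * b * PadicInt.toZMod (g 0) * PadicInt.toZMod (g 1) +
        2 * PadicInt.toZMod (g 2) * PadicInt.toZMod (g 3)) * R2
  have hc : PadicInt.toZMod (g 0) ^ 2 - p * PadicInt.toZMod (g 1) ^ 2 = 0 := by
    by_contra hc
    refine hneg ⟨(PadicInt.toZMod (g 2) ^ 2 - p * PadicInt.toZMod (g 3) ^ 2) /
      (a * (PadicInt.toZMod (g 0) ^ 2 - p * PadicInt.toZMod (g 1) ^ 2)), ?_⟩
    rw [div_mul_div_comm, eq_div_iff (mul_ne_zero (mul_ne_zero ha hc) (mul_ne_zero ha hc))]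
    linear_combination hN
  have hx : PadicInt.toZMod (g 2) ^ 2 - p * PadicInt.toZMod (g 3) ^ 2 = 0 := by
    rw [hc] at hN
    exact pow_eq_zero_iff two_ne_zero |>.1 (by rw [← hN]; ring)
  obtain ⟨h0, h1⟩ := eq_zero_of_sq_sub_mul_sq_eq_zero hp hc
  obtain ⟨h2, h3⟩ := eq_zero_of_sq_sub_mul_sq_eq_zero hp hx
  obtain ⟨c₁', d0⟩ := (PadicInt.toZMod_eq_zero_iff_dvd _).1 h0
  obtain ⟨c₂', d1⟩ := (PadicInt.toZMod_eq_zero_iff_dvd _).1 h1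
  obtain ⟨x₁', d2⟩ := (PadicInt.toZMod_eq_zero_iff_dvd _).1 h2
  obtain ⟨x₂', d3⟩ := (PadicInt.toZMod_eq_zero_iff_dvd _).1 h3
  have hq0 : (q : ℤ_[q]) ≠ 0 := by exact_mod_cast (Fact.out : q.Prime).ne_zero
  rw [d0, d1, d2, d3] at E1 E2
  have F1 : g 4 ^ 2 + p * g 5 ^ 2 = q * ((b : ℤ_[q]) * (c₁' ^ 2 + p * c₂' ^ 2) +
      2 * p * c₁' * c₂' - (x₁' ^ 2 + p * x₂' ^ 2)) := by
    apply mul_left_cancel₀ hq0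
    linear_combination -E1
  have F2 : 2 * g 4 * g 5 = q * (c₁' ^ 2 + p * c₂' ^ 2 + 2 * (b : ℤ_[q]) * c₁' * c₂' -
      2 * x₁' * x₂') := by
    apply mul_left_cancel₀ hq0
    linear_combination -E2
  have R1 := congrArg PadicInt.toZMod F1
  have R2 := congrArg PadicInt.toZMod F2
  simp only [map_add, map_mul, map_pow, map_natCast, map_ofNat, CharP.cast_eq_zero,
    zero_mul] at R1 R2
  have h2ne : (2 : ZMod q) ≠ 0 := by
    intro h
    have : ((2 : ℕ) : ZMod q) = 0 := by exact_mod_cast h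
    rw [ZMod.natCast_eq_zero_iff] at this
    have := Nat.le_of_dvd two_pos this
    omega
  have hp0 : (p : ZMod q) ≠ 0 := fun h => hp (h ▸ IsSquare.zero)
  have h45 : PadicInt.toZMod (g 4) = 0 ∧ PadicInt.toZMod (g 5) = 0 := by
    rcases mul_eq_zero.1 R2 with h | h
    · have h4 := (mul_eq_zero.1 h).resolve_left h2ne
      refine ⟨h4, ?_⟩
      rw [h4] at R1
      simpa [hp0] using R1
    · rw [h] at R1
      exact ⟨by simpa using R1, h⟩
  apply hi
  fin_cases i
  exacts [h0, h1, h2, h3, h45.1, h45.2]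

end PadicReduction

section PrimeCounting

open NumberField IsDedekindDomain Module

variable {K : Type*} [Field K]

theorem dvd_of_intCast_mem {P : Ideal (𝓞 K)} (hP : P ≠ ⊤) {ℓ : ℕ} (hℓ : ℓ.Prime)
    (h : (ℓ : 𝓞 K) ∈ P) {n : ℤ} (hn : (n : 𝓞 K) ∈ P) : (ℓ : ℤ) ∣ n := by
  by_contra hcon
  obtain ⟨u, v, huv⟩ := (Nat.prime_iff_prime_int.1 hℓ).irreducible.coprime_iff_not_dvd.2 hcon
  apply hP
  rw [Ideal.eq_top_iff_one]
  have h1 := P.add_mem (P.mul_mem_left (u : 𝓞 K) h) (P.mul_mem_left (v : 𝓞 K) hn)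
  have h2 : ((u * ℓ + v * n : ℤ) : 𝓞 K) = 1 := by rw [huv]; simp
  push_cast at h2
  rwa [h2] at h1

variable [NumberField K]

theorem absNorm_span_natCast (ℓ : ℕ) :
    Ideal.absNorm (Ideal.span {(ℓ : 𝓞 K)}) = ℓ ^ finrank ℚ K := by
  rw [Ideal.absNorm_span_singleton, ← Int.cast_natCast (R := 𝓞 K), ← eq_intCast (algebraMap ℤ (𝓞 K)),
    Algebra.norm_algebraMap, Int.natAbs_pow, RingOfIntegers.rank, Int.natAbs_natCast]

theorem exists_absNorm_eq_pow {P : Ideal (𝓞 K)} (hP : P ≠ ⊤) {ℓ : ℕ} (hℓ : ℓ.Prime)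
    (h : (ℓ : 𝓞 K) ∈ P) : ∃ k, Ideal.absNorm P = ℓ ^ (k + 1) := by
  have h1 : Ideal.absNorm P ∣ ℓ ^ finrank ℚ K := by
    rw [← absNorm_span_natCast (K := K)]
    exact Ideal.absNorm_dvd_absNorm_of_le ((Ideal.span_singleton_le_iff_mem _).2 h)
  obtain ⟨k, -, hk⟩ := (Nat.dvd_prime_pow hℓ).1 h1
  cases k with
  | zero => exact absurd (Ideal.absNorm_eq_one_iff.1 (by simpa using hk)) hP
  | succ k => exact ⟨k, hk⟩

theorem le_absNorm {P : Ideal (𝓞 K)} (hP : P ≠ ⊤) {ℓ : ℕ} (hℓ : ℓ.Prime)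
    (h : (ℓ : 𝓞 K) ∈ P) : ℓ ^ 1 ≤ Ideal.absNorm P := by
  obtain ⟨k, hk⟩ := exists_absNorm_eq_pow hP hℓ h
  rw [hk]
  exact Nat.pow_le_pow_right hℓ.pos (by omega)

theorem sq_le_absNorm {P : Ideal (𝓞 K)} (hP : P ≠ ⊤) {ℓ : ℕ} (hℓ : ℓ.Prime)
    (h : (ℓ : 𝓞 K) ∈ P) {θ : 𝓞 K} (hθ : ∀ n : ℤ, θ - n ∉ P) : ℓ ^ 2 ≤ Ideal.absNorm P := by
  obtain ⟨k, hk⟩ := exists_absNorm_eq_pow hP hℓ h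
  rw [hk]
  refine Nat.pow_le_pow_right hℓ.pos ?_
  rcases k with - | k
  · exfalso
    have hcard : Nat.card (𝓞 K ⧸ P) = ℓ := by
      rw [← pow_one ℓ, ← zero_add 1, ← hk, Ideal.absNorm_apply, Submodule.cardQuot_apply]
    have := Fact.mk hℓ
    have : Nontrivial (𝓞 K ⧸ P) := Ideal.Quotient.nontrivial_iff.2 hP
    obtain ⟨n, hn⟩ := mem_zmultiples_of_prime_card hcard (g := (1 : 𝓞 K ⧸ P))
      (g' := Ideal.Quotient.mk P θ) one_ne_zero
    apply hθ n
    rw [← Ideal.Quotient.eq_zero_iff_mem, map_sub, ← hn, map_intCast]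
    simp
  · omega

theorem mul_card_le_finrank {ℓ : ℕ} (hℓ : ℓ.Prime) {e f : ℕ}
    {S : Finset (HeightOneSpectrum (𝓞 K))}
    (he : ∀ v ∈ S, v.asIdeal ^ e ∣ Ideal.span {(ℓ : 𝓞 K)})
    (hf : ∀ v ∈ S, ℓ ^ f ≤ Ideal.absNorm v.asIdeal) : e * f * S.card ≤ finrank ℚ K := by
  have h1 : ∏ v ∈ S, v.asIdeal ^ e ∣ Ideal.span {(ℓ : 𝓞 K)} := by
    refine Finset.prod_dvd_of_coprime (fun v _ w _ hvw => ?_) he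
    have := v.isMaximal
    have := w.isMaximal
    exact (Ideal.isCoprime_iff_sup_eq.2 (v.isMaximal.coprime_of_ne w.isMaximal
      fun h => hvw (HeightOneSpectrum.ext h))).pow
  have h2 := map_dvd Ideal.absNorm h1
  rw [absNorm_span_natCast, map_prod] at h2
  have h3 := Nat.le_of_dvd (pow_pos hℓ.pos _) h2
  have h5 : ∏ v ∈ S, ℓ ^ (e * f) ≤ ∏ v ∈ S, Ideal.absNorm (v.asIdeal ^ e) := by
    refine Finset.prod_le_prod' fun v hv => ?_
    rw [map_pow, mul_comm, pow_mul]
    exact Nat.pow_le_pow_left (hf v hv) e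
  rw [Finset.prod_const, ← pow_mul] at h5
  exact (Nat.pow_le_pow_iff_right hℓ.one_lt).1 (h5.trans h3)

theorem exists_finset_heightOneSpectrum {a : 𝓞 K} (ha : a ≠ 0) :
    ∃ S : Finset (HeightOneSpectrum (𝓞 K)), ∀ v : HeightOneSpectrum (𝓞 K), a ∈ v.asIdeal ↔ v ∈ S := by
  have h := Ideal.finite_factors (I := Ideal.span {a}) (by simpa using ha)
  refine ⟨h.toFinset, fun v => ?_⟩
  rw [Set.Finite.mem_toFinset, Set.mem_ofPred_eq, Ideal.dvd_span_singleton]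

/-- A bound for the number of primes above `ℓ` with ramification index at least `e` and residue
degree at least `f`. -/
theorem exists_finset_primes_over {ℓ : ℕ} (hℓ : ℓ.Prime) {e f m : ℕ} (hm : 0 < e * f)
    (hK : finrank ℚ K = e * f * m)
    (he : ∀ v : HeightOneSpectrum (𝓞 K), (ℓ : 𝓞 K) ∈ v.asIdeal →
      v.asIdeal ^ e ∣ Ideal.span {(ℓ : 𝓞 K)})
    (hf : ∀ v : HeightOneSpectrum (𝓞 K), (ℓ : 𝓞 K) ∈ v.asIdeal → ℓ ^ f ≤ Ideal.absNorm v.asIdeal) :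
    ∃ S : Finset (HeightOneSpectrum (𝓞 K)), (∀ v : HeightOneSpectrum (𝓞 K),
      (ℓ : 𝓞 K) ∈ v.asIdeal → v ∈ S) ∧ S.card ≤ m := by
  obtain ⟨S, hS⟩ := exists_finset_heightOneSpectrum (a := (ℓ : 𝓞 K)) (by simpa using hℓ.ne_zero)
  refine ⟨S, fun v => (hS v).1, ?_⟩
  have := mul_card_le_finrank hℓ (fun v hv => he v ((hS v).2 hv)) (fun v hv => hf v ((hS v).2 hv))
  rw [hK] at this
  exact Nat.le_of_mul_le_mul_left this hm

end PrimeCounting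

section SquareIdeals

open NumberField IsDedekindDomain Module

variable {K : Type*} [Field K] [NumberField K]

theorem exists_span_singleton_eq_sq {x y m : 𝓞 K} (hxy : IsCoprime x y)
    (h : Associated (x * y) (m ^ 2)) : ∃ J : Ideal (𝓞 K), Ideal.span {x} = J ^ 2 := by
  refine exists_eq_pow_of_mul_eq_pow_of_coprime (b := Ideal.span {y}) (c := Ideal.span {m})
    ((Ideal.isCoprime_span_singleton_iff x y).2 hxy) ?_
  rw [Ideal.span_singleton_mul_span_singleton, Ideal.span_singleton_pow,
    Ideal.span_singleton_eq_span_singleton]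
  exact h

theorem add_sqrt_mem_selmerTwo {p a b : ℤ} (hab : p = a ^ 2 + b ^ 2) (hcop : IsCoprime (a ^ 2) (2 * b))
    {r : 𝓞 K} (hr : r ^ 2 = p) {δ : Kˣ} (hδ : (δ : K) = algebraMap (𝓞 K) K (b + r)) :
    δ ∈ selmerTwo K := by
  obtain ⟨u, v, huv⟩ := hcop
  have huv' : (u : 𝓞 K) * a ^ 2 + v * (2 * b) = 1 := by exact_mod_cast congrArg (Int.cast (R := 𝓞 K)) huv
  have hp : (p : 𝓞 K) = a ^ 2 + b ^ 2 := by exact_mod_cast congrArg (Int.cast (R := 𝓞 K)) hab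
  have hprod : ((b : 𝓞 K) + r) * (b - r) = -(a : 𝓞 K) ^ 2 := by
    linear_combination -hr - hp
  obtain ⟨J, hJ⟩ := exists_span_singleton_eq_sq (x := (b : 𝓞 K) + r) (y := b - r) (m := (a : 𝓞 K))
    ⟨v - u * (b - r), v, by linear_combination huv' - u * hprod⟩
    (by rw [hprod]; exact Associated.neg_left (Associated.refl _))
  exact mem_selmerTwo_of_eq (a := (b : 𝓞 K) + r) (m := 1) one_ne_zero (by simp [hδ]) hJ

end SquareIdeals

section NonNorm

open Module

theorem ne_norm_mul_sq {K₁ K₂ K₃ : Type*} [Field K₁] [Field K₂] [Field K₃] [Algebra K₁ K₂]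
    [Algebra K₂ K₃] [CharZero K₁] {p q : ℕ} [Fact q.Prime] (hq : q % 4 = 3) {a b : ℤ}
    (hab : (p : ℤ) = a ^ 2 + b ^ 2) (hpq : ¬ IsSquare (p : ZMod q)) (φ : K₁ →+* ℚ_[q])
    (h2 : finrank K₁ K₂ = 2) (hp : ∀ z : K₁, z ^ 2 ≠ p) {r : K₂} (hr : r ^ 2 = p)
    (h3 : finrank K₂ K₃ = 2) (hq' : ∀ z : K₂, z ^ 2 ≠ -q) {s : K₃} (hs : s ^ 2 = -q)
    (x : K₃) (y : K₂) : b + r ≠ Algebra.norm K₂ x * y ^ 2 := by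
  intro h
  have hr' : r ^ 2 = algebraMap K₁ K₂ p := by rw [hr, map_natCast]
  have hs' : s ^ 2 = algebraMap K₂ K₃ (-q) := by rw [hs, map_neg, map_natCast]
  obtain ⟨A, B, rfl⟩ := exists_eq_add_mul h3 hq' hs' x
  rw [norm_add_mul h3 hq' hs'] at h
  obtain ⟨x₁, x₂, hx⟩ := exists_eq_add_mul h2 hp hr' (A * y)
  obtain ⟨y₁, y₂, hy⟩ := exists_eq_add_mul h2 hp hr' (B * y)
  have key := eq_and_eq_of_add_mul_eq hp hr' (a := b) (b := 1)
    (a' := x₁ ^ 2 + p * x₂ ^ 2 + q * (y₁ ^ 2 + p * y₂ ^ 2)) (b' := 2 * x₁ * x₂ + 2 * q * y₁ * y₂) (by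
      have e : (b : K₂) + r = (A * y) ^ 2 + q * (B * y) ^ 2 := by rw [h]; ring
      rw [hx, hy] at e
      simp only [map_add, map_mul, map_pow, map_ofNat, map_natCast, map_intCast, map_one, one_mul]
      rw [e]
      linear_combination ((algebraMap K₁ K₂ x₂) ^ 2 + q * (algebraMap K₁ K₂ y₂) ^ 2) * hr)
  have k1 := congrArg φ key.1
  have k2 := congrArg φ key.2
  simp only [map_add, map_mul, map_pow, map_ofNat, map_natCast, map_intCast, map_one] at k1 k2
  have := Padic.eq_zero_of_twisted_norm_eq hq hab hpq (c₁ := 1) (c₂ := 0)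
    (by rw [← k1]; ring) (by rw [← k2]; ring)
  exact one_ne_zero this.1

end NonNorm

section Tools

open NumberField IsDedekindDomain Module

theorem Rat.sq_ne_of_prime_dvd {m : ℤ} {ℓ : ℤ} (hℓ : Prime ℓ) (h1 : ℓ ∣ m) (h2 : ¬ ℓ ^ 2 ∣ m) (z : ℚ) :
    z ^ 2 ≠ m := by
  intro h
  have hsq : IsSquare (m : ℚ) := ⟨z, by rw [← h, sq]⟩
  obtain ⟨k, rfl⟩ := Rat.isSquare_intCast_iff.1 hsq
  apply h2
  rw [← sq]
  exact pow_dvd_pow_of_dvd ((hℓ.dvd_mul.1 h1).elim id id) 2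

theorem Rat.sq_ne_of_neg {m : ℚ} (hm : m < 0) (z : ℚ) : z ^ 2 ≠ m := fun h => by
  nlinarith [sq_nonneg z]

theorem rank_add_one_eq {K : Type*} [Field K] [NumberField K] {x : K} {m : ℤ} (hm : m < 0)
    (hx : x ^ 2 = m) {k : ℕ} (hk : finrank ℚ K = 2 * k) : Units.rank K + 1 = k := by
  have htc : IsTotallyComplex K := by
    refine ⟨fun w => ?_⟩
    rw [← InfinitePlace.not_isReal_iff_isComplex]
    intro hw
    have h := congrArg (InfinitePlace.embedding_of_isReal hw) hx
    rw [map_pow, map_intCast] at h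
    have : (m : ℝ) < 0 := by exact_mod_cast hm
    nlinarith [sq_nonneg (InfinitePlace.embedding_of_isReal hw x)]
  have h1 := InfinitePlace.card_eq_nrRealPlaces_add_nrComplexPlaces K
  rw [IsTotallyComplex.nrRealPlaces_eq_zero, zero_add] at h1
  have h2 := IsTotallyComplex.finrank K
  have h3 : 0 < Fintype.card (InfinitePlace K) := Fintype.card_pos
  rw [Units.rank]
  omega

theorem exists_ringOfIntegers_of_quadratic {K : Type*} [Field K] {x : K} {t n : ℤ}
    (hx : x ^ 2 - t * x + n = 0) :
    ∃ θ : 𝓞 K, algebraMap (𝓞 K) K θ = x ∧ θ ^ 2 - t * θ + n = 0 := by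
  have hint : IsIntegral ℤ x := by
    refine ⟨Polynomial.X ^ 2 - Polynomial.C t * Polynomial.X + Polynomial.C n, by monicity!, ?_⟩
    simp only [Polynomial.eval₂_add, Polynomial.eval₂_sub, Polynomial.eval₂_mul,
      Polynomial.eval₂_pow, Polynomial.eval₂_X, Polynomial.eval₂_C]
    simp only [eq_intCast]
    exact hx
  obtain ⟨θ, hθ⟩ := (IsIntegralClosure.isIntegral_iff (A := 𝓞 K)).1 hint
  refine ⟨θ, hθ, FaithfulSMul.algebraMap_injective (𝓞 K) K ?_⟩
  rw [map_add, map_sub, map_pow, map_mul, map_intCast, map_intCast, map_zero, hθ]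
  exact hx

variable {F L : Type*} [Field F] [Field L] [Algebra F L]

theorem exists_theta_of_sq_eq [CharZero L] {t n d : ℤ} (hd : t ^ 2 - 4 * n = d) {x : L} (hx : x ^ 2 = d) :
    ∃ θ : 𝓞 L, θ ^ 2 - algebraMap (𝓞 F) (𝓞 L) t * θ + algebraMap (𝓞 F) (𝓞 L) n = 0 := by
  obtain ⟨θ, -, h⟩ := exists_ringOfIntegers_of_quadratic (x := (t + x) / 2) (t := t) (n := n) (by
    have : (d : L) = t ^ 2 - 4 * n := by exact_mod_cast congrArg (Int.cast (R := L)) hd.symm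
    field_simp
    linear_combination hx + this)
  exact ⟨θ, by rw [map_intCast, map_intCast]; exact h⟩

variable [NumberField F] [NumberField L]

theorem relIndex_selmerTwo_dvd (h2 : finrank F L = 2) {t n d : ℤ} (hd : t ^ 2 - 4 * n = d)
    {x : L} (hx : x ^ 2 = d) (hnsq : ∀ z : F, z ^ 2 ≠ d) {S : Finset (HeightOneSpectrum (𝓞 F))}
    (hS : ∀ v : HeightOneSpectrum (𝓞 F), (d : 𝓞 F) ∈ v.asIdeal → v ∈ S) {k m : ℕ}
    (hF : (sqSubgroup Fˣ).relIndex (selmerTwo F) ∣ 2 ^ k) (hm : S.card ≤ m + 1) :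
    (sqSubgroup Lˣ).relIndex (selmerTwo L) ∣ 2 ^ (2 * k + m) := by
  obtain ⟨θ, hθ⟩ := exists_theta_of_sq_eq (F := F) hd hx
  have hd' : ((t : 𝓞 F)) ^ 2 - 4 * n = d := by exact_mod_cast congrArg (Int.cast (R := 𝓞 F)) hd
  have key := two_mul_relIndex_selmerTwo_dvd h2 hθ
    (fun z => by rw [hd', map_intCast]; exact hnsq z) (S := S) (fun v hv => hS v (hd' ▸ hv))
  apply Nat.dvd_of_mul_dvd_mul_left two_pos
  refine key.trans ((mul_dvd_mul (pow_dvd_pow_of_dvd hF 2) (pow_dvd_pow 2 hm)).trans ?_)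
  exact dvd_of_eq (by ring)

theorem relIndex_selmerTwo_dvd_of_ne_norm (h2 : finrank F L = 2) {t n d : ℤ}
    (hd : t ^ 2 - 4 * n = d)
    {x : L} (hx : x ^ 2 = d) (hnsq : ∀ z : F, z ^ 2 ≠ d) {S : Finset (HeightOneSpectrum (𝓞 F))}
    (hS : ∀ v : HeightOneSpectrum (𝓞 F), (d : 𝓞 F) ∈ v.asIdeal → v ∈ S) {s : Fˣ}
    (hs : s ∈ selmerTwo F)
    (hsN : ∀ (x : Lˣ) (y : Fˣ), (s : F) ≠ Algebra.norm F (x : L) * (y : F) ^ 2) {k m : ℕ}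
    (hF : (sqSubgroup Fˣ).relIndex (selmerTwo F) ∣ 2 ^ (k + 1)) (hm : S.card ≤ m) :
    (sqSubgroup Lˣ).relIndex (selmerTwo L) ∣ 2 ^ (2 * k + m) := by
  obtain ⟨θ, hθ⟩ := exists_theta_of_sq_eq (F := F) hd hx
  have hd' : ((t : 𝓞 F)) ^ 2 - 4 * n = d := by exact_mod_cast congrArg (Int.cast (R := 𝓞 F)) hd
  have key := four_mul_relIndex_selmerTwo_dvd h2 hθ
    (fun z => by rw [hd', map_intCast]; exact hnsq z) (S := S) (fun v hv => hS v (hd' ▸ hv)) hs hsN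
  apply Nat.dvd_of_mul_dvd_mul_left four_pos
  refine key.trans ((mul_dvd_mul (pow_dvd_pow_of_dvd hF 2) (pow_dvd_pow 2 hm)).trans ?_)
  exact dvd_of_eq (by ring)

end Tools

section TowerBounds

open NumberField IsDedekindDomain Module

theorem sq_le_absNorm_of_quadratic {K : Type*} [Field K] [NumberField K] {ℓ : ℕ} (hℓ : ℓ.Prime)
    {θ : 𝓞 K} {t n : ℤ} (hθ : θ ^ 2 - t * θ + n = 0) (h : ∀ m : ℤ, ¬ (ℓ : ℤ) ∣ m ^ 2 - t * m + n)
    (v : HeightOneSpectrum (𝓞 K)) (hv : (ℓ : 𝓞 K) ∈ v.asIdeal) :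
    ℓ ^ 2 ≤ Ideal.absNorm v.asIdeal := by
  refine sq_le_absNorm v.isPrime.ne_top hℓ hv (θ := θ) fun m hm => h m ?_
  refine dvd_of_intCast_mem v.isPrime.ne_top hℓ hv ?_
  have := v.asIdeal.mul_mem_left (-(θ + m - t)) hm
  convert this using 1
  push_cast
  linear_combination hθ

theorem pow_one_dvd_span {K : Type*} [Field K] [NumberField K] {ℓ : ℕ} (v : HeightOneSpectrum (𝓞 K))
    (hv : (ℓ : 𝓞 K) ∈ v.asIdeal) : v.asIdeal ^ 1 ∣ Ideal.span {(ℓ : 𝓞 K)} := by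
  rwa [pow_one, Ideal.dvd_span_singleton]

theorem relIndex_selmerTwo_sqrt_neg_two {K : Type*} [Field K] [NumberField K]
    (h2 : finrank ℚ K = 2) {s : K} (hs : s ^ 2 = -2) :
    (sqSubgroup Kˣ).relIndex (selmerTwo K) ∣ 2 ^ 1 := by
  obtain ⟨S, hS, hcard⟩ := exists_finset_primes_over (K := ℚ) Nat.prime_two (e := 1) (f := 1) (m := 1)
    one_pos (by simp) pow_one_dvd_span (fun v hv => le_absNorm v.isPrime.ne_top Nat.prime_two hv)
  refine relIndex_selmerTwo_dvd_of_ne_norm (F := ℚ) h2 (t := 0) (n := 2) (d := -8) (by norm_num)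
    (x := 2 * s) (by push_cast; linear_combination 4 * hs) (Rat.sq_ne_of_neg (by norm_num))
    (fun v hv => hS v ?_) neg_one_mem_selmerTwo
    (neg_one_ne_norm_mul_sq h2 (d := -2) (by norm_num) (r := s) (by simp [hs]))
    (k := 0) relIndex_selmerTwo_rat hcard
  have : (((-8 : ℤ) : 𝓞 ℚ)) = -(2 ^ 3) := by norm_num
  rw [this, neg_mem_iff] at hv
  exact_mod_cast v.isPrime.mem_of_pow_mem _ hv

theorem relIndex_selmerTwo_imaginary {K : Type*} [Field K] [NumberField K] {p q : ℕ} (hp : p.Prime)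
    (hq : q.Prime) (hpq : p * q % 4 = 3) (h2 : finrank ℚ K = 2) {s : K} (hs : s ^ 2 = -(p * q)) :
    (sqSubgroup Kˣ).relIndex (selmerTwo K) ∣ 2 ^ 2 := by
  classical
  obtain ⟨S, hS, hcard⟩ := exists_finset_primes_over (K := ℚ) hp (e := 1) (f := 1) (m := 1)
    one_pos (by simp) pow_one_dvd_span (fun v hv => le_absNorm v.isPrime.ne_top hp hv)
  obtain ⟨T, hT, hcard'⟩ := exists_finset_primes_over (K := ℚ) hq (e := 1) (f := 1) (m := 1)
    one_pos (by simp) pow_one_dvd_span (fun v hv => le_absNorm v.isPrime.ne_top hq hv)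
  have hmod : (p * q : ℤ) % 4 = 3 := by exact_mod_cast hpq
  have hpos : (0 : ℚ) < p * q := by
    have := hp.pos
    have := hq.pos
    positivity
  refine relIndex_selmerTwo_dvd_of_ne_norm (F := ℚ) h2 (t := 1) (n := (p * q + 1) / 4)
    (d := -(p * q)) (by omega) (x := s) (by push_cast; exact hs)
    (Rat.sq_ne_of_neg (by push_cast; linarith)) (S := S ∪ T) (fun v hv => ?_) neg_one_mem_selmerTwo
    (neg_one_ne_norm_mul_sq h2 (d := -(p * q)) (by linarith) (r := s)
      (by rw [map_neg, map_mul, map_natCast, map_natCast]; exact hs))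
    (k := 0) (m := 2) relIndex_selmerTwo_rat ((Finset.card_union_le S T).trans (by omega))
  push_cast at hv
  rw [neg_mem_iff] at hv
  rcases v.isPrime.mem_or_mem hv with h | h
  exacts [Finset.mem_union_left _ (hS v h), Finset.mem_union_right _ (hT v h)]

variable {K₁ K₂ K₃ L : Type*} [Field K₁] [Field K₂] [Field K₃] [Field L]
  [NumberField K₁] [NumberField K₂] [NumberField K₃] [NumberField L]
  [Algebra K₁ K₂] [Algebra K₂ K₃] [Algebra K₃ L]

theorem finrank_rat_eq {F L : Type*} [Field F] [Field L] [NumberField F] [NumberField L]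
    [Algebra F L] {m : ℕ} (h1 : finrank ℚ F = m) (h2 : finrank F L = 2) : finrank ℚ L = m * 2 := by
  rw [← h1, ← h2, finrank_mul_finrank]

variable {p q : ℕ}

theorem sq_ne_of_sqrt_neg_two (h1 : finrank ℚ K₁ = 2) {s : K₁} (hs : s ^ 2 = -2) {m : ℤ}
    (hm : ∀ z : ℚ, z ^ 2 ≠ m) (hm' : ∀ z : ℚ, z ^ 2 ≠ ((-2 * m : ℤ) : ℚ)) (z : K₁) : z ^ 2 ≠ m := by
  have := forall_sq_ne_algebraMap h1 (d := -2) (Rat.sq_ne_of_neg (by norm_num)) (r := s)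
    (by simp [hs]) hm (fun z hz => hm' z (by rw [hz]; push_cast; ring)) z
  rwa [map_intCast] at this

theorem Int.not_sq_dvd_mul_of_not_dvd {ℓ : ℤ} (hℓ : Prime ℓ) {a : ℤ} (h : ¬ ℓ ∣ a) :
    ¬ ℓ ^ 2 ∣ ℓ * a := fun h' =>
  h (Int.dvd_of_mul_dvd_mul_left hℓ.ne_zero (by rwa [sq] at h'))

theorem Rat.sq_ne_prime_mul {ℓ : ℕ} (hℓ : ℓ.Prime) {a : ℤ} (h : ¬ (ℓ : ℤ) ∣ a) (z : ℚ) :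
    z ^ 2 ≠ ((ℓ * a : ℤ) : ℚ) :=
  Rat.sq_ne_of_prime_dvd (Nat.prime_iff_prime_int.1 hℓ) (dvd_mul_right _ _)
    (Int.not_sq_dvd_mul_of_not_dvd (Nat.prime_iff_prime_int.1 hℓ) h) z

theorem sq_ne_prime (hp : p.Prime) (hp8 : p % 8 = 5) (h1 : finrank ℚ K₁ = 2) {s : K₁}
    (hs : s ^ 2 = -2) (z : K₁) : z ^ 2 ≠ p := by
  have := sq_ne_of_sqrt_neg_two h1 hs (m := p) (fun z => ?_) (Rat.sq_ne_of_neg ?_) z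
  · simpa using this
  · simpa using Rat.sq_ne_prime_mul hp (a := 1) (by
      intro h
      have := Int.le_of_dvd one_pos h
      omega) z
  · have : (0 : ℚ) < p := by exact_mod_cast hp.pos
    push_cast
    linarith

theorem relIndex_selmerTwo_sqrt_prime [Fact p.Prime] (hp8 : p % 8 = 5) (h1 : finrank ℚ K₁ = 2)
    {s : K₁} (hs : s ^ 2 = -2) (h2 : finrank K₁ K₂ = 2) {r : K₂} (hr : r ^ 2 = p) :
    (sqSubgroup K₂ˣ).relIndex (selmerTwo K₂) ∣ 2 ^ 2 := by
  have hp : p.Prime := Fact.out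
  obtain ⟨θ, -, hθ⟩ := exists_ringOfIntegers_of_quadratic (x := s) (t := 0) (n := 2)
    (by push_cast; linear_combination hs)
  obtain ⟨S, hS, hcard⟩ := exists_finset_primes_over (K := K₁) hp (e := 1) (f := 2) (m := 1)
    two_pos (by simp [h1]) pow_one_dvd_span (sq_le_absNorm_of_quadratic hp hθ fun m hm => by
      have hsq : IsSquare (-2 : ZMod p) := ⟨m, by
        have := (ZMod.intCast_zmod_eq_zero_iff_dvd _ p).2 hm
        push_cast at this
        linear_combination -this⟩
      rw [ZMod.exists_sq_eq_neg_two_iff (by omega)] at hsq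
      omega)
  refine relIndex_selmerTwo_dvd h2 (t := 1) (n := (1 - p) / 4) (d := p) (by omega) (x := r)
    (by simpa using hr) (by simpa using sq_ne_prime hp hp8 h1 hs) (fun v hv => hS v (by simpa using hv))
    (k := 1) (m := 0) (relIndex_selmerTwo_sqrt_neg_two h1 hs) hcard

end TowerBounds

section PadicSqrt

theorem PadicInt.exists_sq_eq {ℓ : ℕ} [Fact ℓ.Prime] {a u : ℤ_[ℓ]} (h : ‖a ^ 2 - u‖ < ‖2 * a‖ ^ 2) :
    ∃ z : ℤ_[ℓ], z ^ 2 = u := by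
  obtain ⟨z, hz, -⟩ := hensels_lemma (p := ℓ) (F := Polynomial.X ^ 2 - Polynomial.C u) (a := a) (by
    have hd : Polynomial.aeval a (Polynomial.X ^ 2 - Polynomial.C u).derivative = 2 * a := by
      simp [one_add_one_eq_two]
    rw [hd]
    simpa using h)
  exact ⟨z, by simpa [sub_eq_zero] using hz⟩

theorem Padic.exists_sq_eq_neg_two {q : ℕ} [Fact q.Prime] (hq : q % 8 = 3) :
    ∃ z : ℚ_[q], z ^ 2 = -2 := by
  have hq2 : q ≠ 2 := by omega
  obtain ⟨c, hc⟩ := (ZMod.exists_sq_eq_neg_two_iff hq2).2 (Or.inr hq)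
  obtain ⟨a, rfl⟩ := ZMod.intCast_surjective c
  have hdvd : (q : ℤ) ∣ a ^ 2 + 2 := by
    rw [← ZMod.intCast_zmod_eq_zero_iff_dvd]
    push_cast
    linear_combination -hc
  have hq' : Prime (q : ℤ) := Nat.prime_iff_prime_int.1 Fact.out
  have hq2' : ¬ (q : ℤ) ∣ 2 := fun h => by
    have := Int.le_of_dvd two_pos h
    omega
  have hunit : ¬ (q : ℤ) ∣ 2 * a := fun h => by
    rcases hq'.dvd_mul.1 h with h | h
    · exact hq2' h
    · exact hq2' ((dvd_add_right (h.trans (dvd_pow_self a two_ne_zero))).1 hdvd)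
  have h1 : ‖((2 * a : ℤ) : ℤ_[q])‖ = 1 :=
    le_antisymm (PadicInt.norm_le_one _) (not_lt.1 fun h =>
      hunit ((PadicInt.norm_int_lt_one_iff_dvd _).1 h))
  obtain ⟨z, hz⟩ := PadicInt.exists_sq_eq (a := (a : ℤ_[q])) (u := ((-2 : ℤ) : ℤ_[q])) (by
    have h2 := (PadicInt.norm_int_lt_one_iff_dvd _).2 hdvd
    push_cast at h1 h2 ⊢
    rw [h1, sub_neg_eq_add, one_pow]
    exact h2)
  exact ⟨algebraMap _ _ z, by rw [← map_pow, hz, map_intCast]; norm_num⟩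

theorem Padic.exists_sq_eq_of_emod_eight {m : ℤ} (hm : m % 8 = 1) : ∃ z : ℚ_[2], z ^ 2 = m := by
  obtain ⟨z, hz⟩ := PadicInt.exists_sq_eq (ℓ := 2) (a := 1) (u := m) (by
    have h2 : ‖((1 - m : ℤ) : ℤ_[2])‖ ≤ (2 : ℕ) ^ (-(3 : ℕ) : ℤ) := by
      rw [PadicInt.norm_int_le_pow_iff_dvd]
      norm_num
      omega
    have h3 : ‖(2 : ℤ_[2])‖ = 2⁻¹ := by simpa using PadicInt.norm_p (p := 2)
    push_cast at h2
    rw [mul_one, h3, one_pow]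
    refine h2.trans_lt ?_
    norm_num)
  exact ⟨algebraMap _ _ z, by rw [← map_pow, hz, map_intCast]⟩

end PadicSqrt

section TowerBounds

open NumberField IsDedekindDomain Module

variable {K₁ K₂ K₃ L : Type*} [Field K₁] [Field K₂] [Field K₃] [Field L]
  [NumberField K₁] [Algebra K₁ K₂] [Algebra K₂ K₃] [Algebra K₃ L]
  {p q : ℕ}

theorem sq_ne_of_sq_eq_intCast {F L : Type*} [Field F] [Field L] [CharZero F] [Algebra F L]
    (h2 : finrank F L = 2) {d : ℤ} (hd : ∀ z : F, z ^ 2 ≠ d) {r : L} (hr : r ^ 2 = d) {m : ℤ}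
    (hm : ∀ z : F, z ^ 2 ≠ m) (hm' : ∀ z : F, z ^ 2 ≠ ((m * d : ℤ) : F)) (z : L) : z ^ 2 ≠ m := by
  have := forall_sq_ne_algebraMap h2 hd (by rw [hr, map_intCast]) hm
    (fun z hz => hm' z (by rw [hz, Int.cast_mul])) z
  rwa [map_intCast] at this

theorem Nat.Prime.not_dvd_intCast {ℓ p : ℕ} (hℓ : ℓ.Prime) (hp : p.Prime) (h : ℓ ≠ p) :
    ¬ (ℓ : ℤ) ∣ p := fun h' => h ((Nat.prime_dvd_prime_iff_eq hℓ hp).1 (by exact_mod_cast h'))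

/-- Integers that are, up to sign, divisible by one of two primes exactly once stay nonsquares in
a quadratic field `ℚ(√-2)`. -/
theorem sq_ne_mul_of_sqrt_neg_two {ℓ : ℕ} (hℓ : ℓ.Prime) (hℓ2 : ℓ ≠ 2) (h1 : finrank ℚ K₁ = 2)
    {s : K₁} (hs : s ^ 2 = -2) {a : ℤ} (ha : ¬ (ℓ : ℤ) ∣ a) (z : K₁) :
    z ^ 2 ≠ ((ℓ * a : ℤ) : K₁) := by
  refine sq_ne_of_sqrt_neg_two h1 hs (Rat.sq_ne_prime_mul hℓ ha) (fun z => ?_) z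
  rw [mul_left_comm]
  refine Rat.sq_ne_prime_mul hℓ (fun h => ?_) z
  rcases (Nat.prime_iff_prime_int.1 hℓ).dvd_mul.1 h with h | h
  · exact hℓ.not_dvd_intCast Nat.prime_two hℓ2 (by simpa using h)
  · exact ha h

theorem sq_ne_neg_one_of_sqrt_neg_two (h1 : finrank ℚ K₁ = 2) {s : K₁} (hs : s ^ 2 = -2) (z : K₁) :
    z ^ 2 ≠ ((-1 : ℤ) : K₁) := by
  refine sq_ne_of_sqrt_neg_two h1 hs (Rat.sq_ne_of_neg (by norm_num)) (fun z => ?_) z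
  simpa using Rat.sq_ne_prime_mul Nat.prime_two (a := 1) (by norm_num) z

theorem sq_ne_neg_prime (hp : p.Prime) (hp8 : p % 8 = 5) (hq : q.Prime) (hq8 : q % 8 = 3)
    (h1 : finrank ℚ K₁ = 2) {s : K₁} (hs : s ^ 2 = -2) (h2 : finrank K₁ K₂ = 2) {r : K₂}
    (hr : r ^ 2 = p) (z : K₂) : z ^ 2 ≠ ((-q : ℤ) : K₂) := by
  have hqp := hq.not_dvd_intCast hp (by rintro rfl; omega)
  have hq2 : q ≠ 2 := by rintro rfl; omega
  have hq1 : ¬ (q : ℤ) ∣ 1 := fun h => hq.not_dvd_one (by exact_mod_cast h)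
  refine sq_ne_of_sq_eq_intCast h2 (d := p) (by simpa using sq_ne_prime hp hp8 h1 hs)
    (by simpa using hr) (fun z => ?_) (fun z => ?_) z
  · simpa using sq_ne_mul_of_sqrt_neg_two hq hq2 h1 hs (a := -1) (by simpa using hq1) z
  · simpa using sq_ne_mul_of_sqrt_neg_two hq hq2 h1 hs (a := -p) (by simpa using hqp) z

variable [NumberField K₂]

theorem sq_ne_neg_one (hp : p.Prime) (hp8 : p % 8 = 5) (hq : q.Prime) (hq8 : q % 8 = 3)
    (h1 : finrank ℚ K₁ = 2) {s : K₁} (hs : s ^ 2 = -2) (h2 : finrank K₁ K₂ = 2) {r : K₂}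
    (hr : r ^ 2 = p) (h3 : finrank K₂ K₃ = 2) {t : K₃} (ht : t ^ 2 = -q) (z : K₃) :
    z ^ 2 ≠ -1 := by
  have hqp := hq.not_dvd_intCast hp (by rintro rfl; omega)
  have hq2 : q ≠ 2 := by rintro rfl; omega
  have hp2 : p ≠ 2 := by rintro rfl; omega
  have hq1 : ¬ (q : ℤ) ∣ 1 := fun h => hq.not_dvd_one (by exact_mod_cast h)
  have hp1 : ¬ (p : ℤ) ∣ 1 := fun h => hp.not_dvd_one (by exact_mod_cast h)
  have hsqp : ∀ z : K₁, z ^ 2 ≠ ((p : ℤ) : K₁) := by simpa using sq_ne_prime hp hp8 h1 hs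
  have hr' : r ^ 2 = ((p : ℤ) : K₂) := by simpa using hr
  have := sq_ne_of_sq_eq_intCast h3 (d := -q) (sq_ne_neg_prime hp hp8 hq hq8 h1 hs h2 hr)
    (by simpa using ht) (m := -1)
    (sq_ne_of_sq_eq_intCast h2 hsqp hr' (sq_ne_neg_one_of_sqrt_neg_two h1 hs) fun z => by
      simpa using sq_ne_mul_of_sqrt_neg_two hp hp2 h1 hs (a := -1) (by simpa using hp1) z)
    (sq_ne_of_sq_eq_intCast h2 hsqp hr'
      (fun z => by
        simpa using sq_ne_mul_of_sqrt_neg_two hq hq2 h1 hs (a := 1) hq1 z)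
      fun z => by
        simpa using sq_ne_mul_of_sqrt_neg_two hq hq2 h1 hs (a := p) hqp z) z
  simpa using this

theorem exists_sq_add_sq_isCoprime (hp : p.Prime) (hp8 : p % 4 = 1) :
    ∃ a b : ℤ, (p : ℤ) = a ^ 2 + b ^ 2 ∧ IsCoprime (a ^ 2) (2 * b) := by
  have := Fact.mk hp
  obtain ⟨a, b, hab⟩ := Nat.Prime.sq_add_sq (p := p) (by omega)
  wlog ha : a % 2 = 1 generalizing a b
  · refine this b a (by rw [← hab, add_comm]) ?_
    by_contra hb
    have h1 : 2 ∣ a := by omega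
    have h2 : 2 ∣ b := by omega
    have : 2 ∣ p := hab ▸ dvd_add (h1.trans (dvd_pow_self a two_ne_zero)) (h2.trans (dvd_pow_self b two_ne_zero))
    omega
  refine ⟨a, b, by exact_mod_cast hab.symm, IsCoprime.pow_left (IsCoprime.mul_right ?_ ?_)⟩
  · rw [← Nat.cast_two, Nat.isCoprime_iff_coprime]
    exact Nat.coprime_two_right.2 (Nat.odd_iff.2 ha)
  · rw [Nat.isCoprime_iff_coprime]
    refine Nat.Coprime.symm (Nat.coprime_of_dvd fun ℓ hℓ h1 h2 => ?_)
    have h3 : ℓ ^ 2 ∣ p := hab ▸ dvd_add (pow_dvd_pow_of_dvd h2 2) (pow_dvd_pow_of_dvd h1 2)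
    have h4 := (Nat.prime_dvd_prime_iff_eq hℓ hp).1 ((dvd_pow_self ℓ two_ne_zero).trans h3)
    subst h4
    have h5 := Nat.le_of_dvd hp.pos h3
    nlinarith [hp.two_le]

variable [NumberField K₃] [NumberField L]

theorem relIndex_selmerTwo_sqrt_neg_prime [Fact p.Prime] [Fact q.Prime] (hp8 : p % 8 = 5)
    (hq8 : q % 8 = 3) (hpq : ¬ IsSquare (p : ZMod q)) (h1 : finrank ℚ K₁ = 2) {s : K₁} (hs : s ^ 2 = -2)
    (h2 : finrank K₁ K₂ = 2) {r : K₂} (hr : r ^ 2 = p) (h3 : finrank K₂ K₃ = 2) {t : K₃}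
    (ht : t ^ 2 = -q) : (sqSubgroup K₃ˣ).relIndex (selmerTwo K₃) ∣ 2 ^ 4 := by
  have hp : p.Prime := Fact.out
  have hq : q.Prime := Fact.out
  obtain ⟨a, b, hab, hcop⟩ := exists_sq_add_sq_isCoprime hp (by omega)
  obtain ⟨θ, hθr, hθ⟩ := exists_ringOfIntegers_of_quadratic (x := r) (t := 0) (n := -p)
    (by push_cast; linear_combination hr)
  obtain ⟨S, hS, hcard⟩ := exists_finset_primes_over (K := K₂) hq (e := 1) (f := 2) (m := 2)
    two_pos (by rw [finrank_rat_eq h1 h2]) pow_one_dvd_span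
    (sq_le_absNorm_of_quadratic hq hθ fun m hm => hpq ⟨m, by
        have := (ZMod.intCast_zmod_eq_zero_iff_dvd _ q).2 hm
        push_cast at this
        linear_combination -this⟩)
  have hθ' : θ ^ 2 = (p : ℤ) := by
    push_cast at hθ ⊢
    linear_combination hθ
  obtain ⟨ρ, hρ⟩ := Padic.exists_sq_eq_neg_two (q := q) hq8
  obtain ⟨φ, -⟩ := exists_ringHom_of_sq_eq h1 (d := -2) (Rat.sq_ne_of_neg (by norm_num)) (r := s)
    (by simp [hs]) (ρ := ρ) (by simp [hρ])
  have hsq := sq_ne_neg_prime hp hp8 hq hq8 h1 hs h2 hr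
  have hsq' : ∀ z : K₂, z ^ 2 ≠ -q := by simpa using hsq
  have hnorm := ne_norm_mul_sq (by omega) hab hpq φ.toRingHom h2 (sq_ne_prime hp hp8 h1 hs) hr h3 hsq' ht
  have hne : (b : K₂) + r ≠ 0 := fun h => hnorm 0 0 (by simpa using h)
  refine relIndex_selmerTwo_dvd_of_ne_norm h3 (t := 1) (n := (1 + q) / 4) (d := -q) (by omega)
    (x := t) (by simpa using ht) hsq (fun v hv => hS v (by simpa using hv))
    (add_sqrt_mem_selmerTwo hab hcop hθ' (δ := Units.mk0 _ hne) (by simp [hθr]))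
    (fun x y => hnorm x y) (k := 1) (m := 2) (relIndex_selmerTwo_sqrt_prime hp8 h1 hs h2 hr) hcard

theorem relIndex_selmerTwo_i [Fact p.Prime] [Fact q.Prime] (hp8 : p % 8 = 5)
    (hq8 : q % 8 = 3) (hpq : ¬ IsSquare (p : ZMod q)) (h1 : finrank ℚ K₁ = 2) {s : K₁} (hs : s ^ 2 = -2)
    (h2 : finrank K₁ K₂ = 2) {r : K₂} (hr : r ^ 2 = p) (h3 : finrank K₂ K₃ = 2) {t : K₃}
    (ht : t ^ 2 = -q) (h4 : finrank K₃ L = 2) {i : L} (hi : i ^ 2 = -1) :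
    (sqSubgroup Lˣ).relIndex (selmerTwo L) ∣ 2 ^ 9 := by
  have hp : p.Prime := Fact.out
  have hq : q.Prime := Fact.out
  obtain ⟨σ, -, hσ⟩ := exists_ringOfIntegers_of_quadratic (x := algebraMap K₂ K₃ (algebraMap K₁ K₂ s))
    (t := 0) (n := 2) (by
      have h : algebraMap K₂ K₃ (algebraMap K₁ K₂ s) ^ 2 = -2 := by
        rw [← map_pow, ← map_pow, hs, map_neg, map_neg, map_ofNat, map_ofNat]
      push_cast
      linear_combination h)
  obtain ⟨ω, -, hω⟩ := exists_ringOfIntegers_of_quadratic (x := (1 + algebraMap K₂ K₃ r) / 2)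
    (t := 1) (n := (1 - p) / 4) (by
      have h : ((4 * ((1 - p) / 4) : ℤ) : K₃) = ((1 - p : ℤ) : K₃) := by
        congr 1
        omega
      have hr' : (algebraMap K₂ K₃ r) ^ 2 = p := by rw [← map_pow, hr, map_natCast]
      push_cast at h ⊢
      linear_combination hr' / 4 + h / 4)
  obtain ⟨S, hS, hcard⟩ := exists_finset_primes_over (K := K₃) Nat.prime_two (e := 2) (f := 2) (m := 2)
    four_pos (by rw [finrank_rat_eq (finrank_rat_eq h1 h2) h3]) (fun v hv => by
      have h : Ideal.span {((2 : ℕ) : 𝓞 K₃)} = Ideal.span {σ} ^ 2 := by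
        rw [Ideal.span_singleton_pow, Ideal.span_singleton_eq_span_singleton]
        have : σ ^ 2 = -((2 : ℕ) : 𝓞 K₃) := by
          push_cast at hσ ⊢
          linear_combination hσ
        rw [this]
        exact (Associated.refl _).neg_right
      rw [h]
      refine pow_dvd_pow_of_dvd ?_ 2
      rw [← Ideal.dvd_span_singleton, h] at hv
      exact v.prime.dvd_of_dvd_pow hv)
    (sq_le_absNorm_of_quadratic Nat.prime_two hω fun m hm => by
      have h1 : (m ^ 2 - 1 * m) % 2 = 0 := by
        have := Int.even_mul_pred_self m
        have h : m ^ 2 - 1 * m = m * (m - 1) := by ring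
        rw [h]
        exact Int.even_iff.1 this
      push_cast at hm
      omega)
  have hsq := sq_ne_neg_one hp hp8 hq hq8 h1 hs h2 hr h3 ht
  refine relIndex_selmerTwo_dvd h4 (t := 0) (n := 1) (d := -4) (by norm_num) (x := 2 * i)
    (by push_cast; linear_combination 4 * hi)
    (fun z hz => hsq (z / 2) (by push_cast at hz; linear_combination hz / 4)) (S := S)
    (fun v hv => hS v ?_) (k := 4) (m := 1)
    (relIndex_selmerTwo_sqrt_neg_prime hp8 hq8 hpq h1 hs h2 hr h3 ht) hcard
  have : (((-4 : ℤ) : 𝓞 K₃)) = -(2 ^ 2) := by norm_num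
  rw [this, neg_mem_iff] at hv
  exact_mod_cast v.isPrime.mem_of_pow_mem _ hv

end TowerBounds

section ClassGroupBounds

open NumberField Module

variable {K : Type*} [Field K] [NumberField K]

theorem card_classGroup_two_torsion_dvd {k m n : ℕ} (hr : Units.rank K + 1 = k)
    (h : (sqSubgroup Kˣ).relIndex (selmerTwo K) ∣ 2 ^ n) (hn : n = m + k) :
    Nat.card (powMonoidHom 2 : ClassGroup (𝓞 K) →* ClassGroup (𝓞 K)).ker ∣ 2 ^ m := by
  have := (card_classGroup_two_torsion_mul_dvd K).trans h
  rw [hr, hn, pow_add] at this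
  exact Nat.dvd_of_mul_dvd_mul_right (by positivity) this

open nonZeroDivisors in
theorem factorization_two_card_classGroup_eq_one
    (hK : Nat.card (powMonoidHom 2 : ClassGroup (𝓞 K) →* ClassGroup (𝓞 K)).ker ∣ 2)
    {I : Ideal (𝓞 K)} (hI0 : I ≠ ⊥) {a : 𝓞 K} (hI : I ^ 2 = Ideal.span {a})
    (hns : ∀ (x y : 𝓞 K) (J : Ideal (𝓞 K)), x ≠ 0 → y ≠ 0 → J ≠ ⊥ →
      Ideal.span {x} * I ≠ Ideal.span {y} * J ^ 2) :
    (Nat.card (ClassGroup (𝓞 K))).factorization 2 = 1 := by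
  have hmem : ∀ {J : Ideal (𝓞 K)}, J ≠ ⊥ → J ∈ (Ideal (𝓞 K))⁰ := mem_nonZeroDivisors_iff_ne_zero.2
  refine factorization_two_card_eq_one hK (g := ClassGroup.mk0 ⟨I, hmem hI0⟩) ?_ ?_
  · rw [← map_pow, ClassGroup.mk0_eq_one_iff]
    exact ⟨a, by simpa using hI⟩
  · intro c hc
    obtain ⟨J, rfl⟩ := ClassGroup.mk0_surjective c
    rw [← map_pow, eq_comm, ClassGroup.mk0_eq_mk0_iff] at hc
    obtain ⟨x, y, hx, hy, h⟩ := hc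
    exact hns x y J hx hy (nonZeroDivisors.ne_zero J.2) (by simpa using h)

end ClassGroupBounds

section PrimeAboveP

open NumberField Module

theorem Padic.eq_zero_of_sq_eq_add {p q : ℕ} [Fact q.Prime] (hp : ¬ IsSquare (p : ZMod q))
    {a b c : ℚ_[q]} (h : c ^ 2 = p * a ^ 2 + q * b ^ 2) : c = 0 := by
  by_contra hcon
  set f : Fin 3 → ℚ_[q] := ![c, a, b] with hf
  obtain ⟨k, g, hk, hg, i, hi⟩ := Padic.exists_scaling f (i₀ := 0) hcon
  have E : g 0 ^ 2 = p * g 1 ^ 2 + q * g 2 ^ 2 := by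
    apply Subtype.coe_injective
    push_cast
    rw [hg, hg, hg]
    simp only [hf, Matrix.cons_val]
    linear_combination k ^ 2 * h
  have R := congrArg PadicInt.toZMod E
  simp only [map_add, map_mul, map_pow, map_natCast, CharP.cast_eq_zero, zero_mul, add_zero] at R
  obtain ⟨h0, h1⟩ := eq_zero_of_sq_sub_mul_sq_eq_zero hp (sub_eq_zero.2 R)
  obtain ⟨x, hx⟩ := (PadicInt.toZMod_eq_zero_iff_dvd _).1 h0
  obtain ⟨y, hy⟩ := (PadicInt.toZMod_eq_zero_iff_dvd _).1 h1
  have hq0 : (q : ℤ_[q]) ≠ 0 := by exact_mod_cast (Fact.out : q.Prime).ne_zero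
  have F : g 2 ^ 2 = q * (x ^ 2 - p * y ^ 2) := by
    apply mul_left_cancel₀ hq0
    rw [hx, hy] at E
    linear_combination -E
  have R' := congrArg PadicInt.toZMod F
  simp only [map_mul, map_pow, map_natCast, CharP.cast_eq_zero, zero_mul] at R'
  have h2 := pow_eq_zero_iff two_ne_zero |>.1 R'
  fin_cases i
  exacts [hi h0, hi h1, hi h2]

variable {K : Type*} [Field K] [NumberField K] {p q : ℕ}

theorem norm_int_mul_norm_int (h2 : finrank ℚ K = 2) {d : ℕ} (hd : 0 < d) {s : K} (hs : s ^ 2 = -d)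
    (x : 𝓞 K) : ∃ a b : ℚ, (x : K) = algebraMap ℚ K a + algebraMap ℚ K b * s ∧
      ((Algebra.norm ℤ x : ℤ) : ℚ) = a ^ 2 + d * b ^ 2 := by
  have hd' : ∀ z : ℚ, z ^ 2 ≠ -d := Rat.sq_ne_of_neg (by simpa using hd)
  have hs' : s ^ 2 = algebraMap ℚ K (-d) := by rw [hs, map_neg, map_natCast]
  obtain ⟨a, b, hab⟩ := exists_eq_add_mul h2 hd' hs' (x : K)
  refine ⟨a, b, hab, ?_⟩
  rw [Algebra.coe_norm_int, hab, norm_add_mul h2 hd' hs']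
  ring

theorem span_prime_sqrt_sq (hpq : Nat.Coprime p q) {σ : 𝓞 K} (hσ : σ ^ 2 = -(p * q)) :
    Ideal.span {(p : 𝓞 K), σ} ^ 2 = Ideal.span {(p : 𝓞 K)} := by
  obtain ⟨u, v, huv⟩ := Nat.isCoprime_iff_coprime.2 hpq
  have huv' : (u : 𝓞 K) * p + v * q = 1 := by exact_mod_cast congrArg (Int.cast (R := 𝓞 K)) huv
  rw [sq, Ideal.span_pair_mul_span_pair]
  apply le_antisymm
  · rw [Ideal.span_le]
    rintro z (rfl | rfl | rfl | rfl)
    · exact Ideal.mem_span_singleton.2 ⟨p, rfl⟩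
    · exact Ideal.mem_span_singleton.2 ⟨σ, rfl⟩
    · exact Ideal.mem_span_singleton.2 ⟨σ, by ring⟩
    · exact Ideal.mem_span_singleton.2 ⟨-q, by linear_combination hσ⟩
  · rw [Ideal.span_singleton_le_iff_mem]
    have e : (p : 𝓞 K) = u * (p * p) - v * (σ * σ) := by linear_combination -p * huv' + v * hσ
    have h1 : (p * p : 𝓞 K) ∈ Ideal.span {(p * p : 𝓞 K), p * σ, σ * p, σ * σ} :=
      Ideal.subset_span (by simp)
    have h2 : σ * σ ∈ Ideal.span {(p * p : 𝓞 K), p * σ, σ * p, σ * σ} :=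
      Ideal.subset_span (by simp)
    have := sub_mem (Ideal.mul_mem_left _ (u : 𝓞 K) h1) (Ideal.mul_mem_left _ (v : 𝓞 K) h2)
    rwa [← e] at this

theorem span_mul_span_prime_sqrt_ne [Fact p.Prime] [Fact q.Prime] (hpq : ¬ IsSquare (p : ZMod q))
    (h2 : finrank ℚ K = 2) {s : K} (hs : s ^ 2 = -(p * q)) {I : Ideal (𝓞 K)}
    (hI : I ^ 2 = Ideal.span {(p : 𝓞 K)}) {x y : 𝓞 K} {J : Ideal (𝓞 K)} (hy : y ≠ 0)
    (hJ : J ≠ ⊥) : Ideal.span {x} * I ≠ Ideal.span {y} * J ^ 2 := by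
  intro h
  have hp : p.Prime := Fact.out
  have hq : q.Prime := Fact.out
  have hIn : Ideal.absNorm I = p := by
    have := congrArg Ideal.absNorm hI
    rw [map_pow, absNorm_span_natCast, h2] at this
    exact Nat.pow_left_injective two_ne_zero this
  have hN := congrArg Ideal.absNorm h
  rw [map_mul, map_mul, map_pow, Ideal.absNorm_span_singleton, Ideal.absNorm_span_singleton, hIn] at hN
  have hs' : s ^ 2 = -((p * q : ℕ) : K) := by rw [hs, Nat.cast_mul]
  have hpos : 0 < p * q := mul_pos hp.pos hq.pos
  have hnn : ∀ z : 𝓞 K, (((Algebra.norm ℤ z).natAbs : ℕ) : ℤ) = Algebra.norm ℤ z := fun z => by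
    obtain ⟨a, b, -, hz⟩ := norm_int_mul_norm_int h2 hpos hs' z
    refine Int.natAbs_of_nonneg ?_
    have : (0 : ℚ) ≤ (Algebra.norm ℤ z : ℤ) := by
      rw [hz]
      positivity
    exact_mod_cast this
  have hN' := congrArg (Nat.cast (R := ℤ)) hN
  push_cast [hnn] at hN'
  obtain ⟨a, b, -, hab⟩ := norm_int_mul_norm_int h2 hpos hs' (x * y)
  have hny : Algebra.norm ℤ y ≠ 0 := Algebra.norm_ne_zero_iff.2 hy
  have hm : (Ideal.absNorm J : ℤ) ≠ 0 := by
    simpa [Ideal.absNorm_eq_zero_iff] using hJ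
  have key : ((Algebra.norm ℤ y * Ideal.absNorm J : ℤ) : ℚ) ^ 2 = p * a ^ 2 + q * (p * b) ^ 2 := by
    have e : ((Algebra.norm ℤ y * Ideal.absNorm J) ^ 2 : ℤ) = p * Algebra.norm ℤ (x * y) := by
      rw [map_mul]
      linear_combination -Algebra.norm ℤ y * hN'
    rw [← Int.cast_pow, e, Int.cast_mul, hab]
    push_cast
    ring
  have := Padic.eq_zero_of_sq_eq_add hpq (a := a) (b := p * b)
    (c := ((Algebra.norm ℤ y * Ideal.absNorm J : ℤ) : ℚ_[q]))
    (by exact_mod_cast congrArg (Rat.cast (K := ℚ_[q])) key)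
  exact mul_ne_zero hny hm (by exact_mod_cast this)

theorem factorization_two_card_classGroup_imaginary [Fact p.Prime] [Fact q.Prime]
    (hmod : p * q % 4 = 3) (hpq : ¬ IsSquare (p : ZMod q))
    (h2 : finrank ℚ K = 2) {s : K} (hs : s ^ 2 = -(p * q)) :
    (Nat.card (ClassGroup (𝓞 K))).factorization 2 = 1 := by
  have hp : p.Prime := Fact.out
  have hq : q.Prime := Fact.out
  obtain ⟨σ, -, hσ⟩ := exists_ringOfIntegers_of_quadratic (x := s) (t := 0) (n := p * q)
    (by push_cast; linear_combination hs)
  have hne : p ≠ q := by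
    rintro rfl
    exact hpq ⟨0, by simp⟩
  have hI := span_prime_sqrt_sq ((Nat.coprime_primes hp hq).2 hne) (σ := σ)
    (by push_cast at hσ; linear_combination hσ)
  have hr : Units.rank K + 1 = 1 := rank_add_one_eq (x := s) (m := -(p * q))
    (by have : (0 : ℤ) < p * q := by exact_mod_cast mul_pos hp.pos hq.pos
        linarith) (by push_cast; exact hs) h2
  refine factorization_two_card_classGroup_eq_one
    (card_classGroup_two_torsion_dvd (m := 1) hr (relIndex_selmerTwo_imaginary hp hq hmod h2 hs) rfl)
    ?_ hI (fun x y J _ hy hJ => span_mul_span_prime_sqrt_ne hpq h2 hs hI hy hJ)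
  rintro h
  rw [h, eq_comm, ← Ideal.zero_eq_bot, zero_pow two_ne_zero, Ideal.zero_eq_bot,
    Ideal.span_singleton_eq_bot] at hI
  exact hp.ne_zero (by exact_mod_cast hI)

end PrimeAboveP

section DyadicNormForm

open Module

theorem PadicInt.toZMod_eq_zero_of_four_mul_toZModPow_eq_zero {g : ℤ_[2]}
    (h : 4 * PadicInt.toZModPow 3 g = 0) : PadicInt.toZMod g = 0 := by
  have h' : PadicInt.toZModPow 3 (4 * g) = 0 := by rw [map_mul, map_ofNat, h]
  rw [← RingHom.mem_ker, PadicInt.ker_toZModPow, Ideal.mem_span_singleton] at h'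
  obtain ⟨c, hc⟩ := h'
  rw [PadicInt.toZMod_eq_zero_iff_dvd]
  refine ⟨c, ?_⟩
  have h4 : (4 : ℤ_[2]) ≠ 0 := by norm_num
  apply mul_left_cancel₀ h4
  rw [hc]
  push_cast
  ring

set_option maxRecDepth 10000 in
theorem ZMod.four_mul_eq_zero_of_sq_mul_eq : ∀ e w x y z : ZMod (2 ^ 3), e = 1 ∨ e = -1 → w = 3 ∨ w = 5 →
    x ^ 2 * w = e * (y ^ 2 - 2 * z ^ 2) → 4 * x = 0 ∧ 4 * y = 0 ∧ 4 * z = 0 := by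
  rintro e w x y z (rfl | rfl) (rfl | rfl) <;> revert x y z <;> decide

theorem Padic.ne_sq_sub_two_mul_sq {w : ℤ_[2]} (hw : PadicInt.toZModPow 3 w = 3 ∨ PadicInt.toZModPow 3 w = 5)
    {e : ℤ} (he : e = 1 ∨ e = -1) (a b : ℚ_[2]) : (w : ℚ_[2]) ≠ e * (a ^ 2 - 2 * b ^ 2) := by
  intro h
  set f : Fin 3 → ℚ_[2] := ![1, a, b] with hf
  obtain ⟨k, g, hk, hg, i, hi⟩ := Padic.exists_scaling f (i₀ := 0) one_ne_zero
  have h2c : ((2 : ℤ_[2]) : ℚ_[2]) = 2 := map_ofNat PadicInt.Coe.ringHom 2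
  have E : g 0 ^ 2 * w = e * (g 1 ^ 2 - 2 * g 2 ^ 2) := by
    apply Subtype.coe_injective
    push_cast
    rw [h2c, hg, hg, hg]
    simp only [hf, Matrix.cons_val]
    linear_combination k ^ 2 * h
  have R := congrArg (PadicInt.toZModPow 3) E
  simp only [map_sub, map_mul, map_pow, map_intCast, map_ofNat] at R
  obtain ⟨h0, h1, h2⟩ := ZMod.four_mul_eq_zero_of_sq_mul_eq _ _ _ _ _
    (by rcases he with rfl | rfl <;> simp) hw R
  fin_cases i
  exacts [hi (PadicInt.toZMod_eq_zero_of_four_mul_toZModPow_eq_zero h0),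
    hi (PadicInt.toZMod_eq_zero_of_four_mul_toZModPow_eq_zero h1),
    hi (PadicInt.toZMod_eq_zero_of_four_mul_toZModPow_eq_zero h2)]

theorem Padic.exists_toZModPow_eq {W W' : ℚ_[2]} {x : ℤ} (hx : x % 2 = 1) {k : ℕ} (hk : 2 ≤ k)
    (hadd : W + W' = x) (hmul : W * W' = 4 ^ k) :
    ∃ v : ℤ_[2], ((v : ℚ_[2]) = W ∨ (v : ℚ_[2]) = W') ∧ PadicInt.toZModPow 3 v = x := by
  wlog h : ‖W'‖ ≤ ‖W‖ generalizing W W'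
  · obtain ⟨v, hv, hvx⟩ := this (by rw [add_comm, hadd]) (by rw [mul_comm, hmul]) (le_of_not_ge h)
    exact ⟨v, hv.symm, hvx⟩
  have hx1 : ‖(x : ℚ_[2])‖ = 1 := by
    refine le_antisymm (Padic.norm_int_le_one x) (not_lt.1 fun hlt => ?_)
    rw [Padic.norm_intCast_lt_one_iff] at hlt
    omega
  have h4 : ‖(4 : ℚ_[2]) ^ k‖ ≤ (1 / 4) ^ 2 := by
    have e : (4 : ℚ_[2]) = ((2 : ℕ) : ℚ_[2]) ^ 2 := by norm_num
    rw [e, norm_pow, norm_pow, Padic.norm_p]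
    refine (pow_le_pow_of_le_one (by norm_num) (by norm_num) hk).trans ?_
    norm_num
  have hn : ‖W‖ * ‖W'‖ ≤ (1 / 4) ^ 2 := by rwa [← norm_mul, hmul]
  have hlt : ‖W'‖ < ‖W‖ := by
    refine lt_of_le_of_ne h fun heq => ?_
    have h1 : ‖W‖ < 1 := by
      rw [heq] at hn
      nlinarith [norm_nonneg W]
    have h2 := Padic.nonarchimedean W W'
    rw [hadd, hx1, heq, max_self] at h2
    linarith
  have hW : ‖W‖ = 1 := by
    have := Padic.add_eq_max_of_ne hlt.ne'
    rw [hadd, hx1, max_eq_left h] at this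
    exact this.symm
  have hW' : ‖W'‖ ≤ (1 / 4) ^ 2 := by rwa [hW, one_mul] at hn
  obtain ⟨v, rfl⟩ : ∃ v : ℤ_[2], (v : ℚ_[2]) = W := ⟨⟨W, hW.le⟩, rfl⟩
  refine ⟨v, Or.inl rfl, ?_⟩
  rw [← map_intCast (PadicInt.toZModPow (p := 2) 3), ← sub_eq_zero, ← map_sub, ← RingHom.mem_ker,
    PadicInt.ker_toZModPow, ← PadicInt.norm_le_pow_iff_mem_span_pow, PadicInt.norm_def]
  push_cast
  have e : (v : ℚ_[2]) - x = -W' := by rw [← hadd]; ring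
  rw [e, norm_neg]
  refine hW'.trans ?_
  norm_num

theorem ne_sq_sub_two_mul_sq_of_sqrt_neg {K : Type*} [Field K] [CharZero K] (h2 : finrank ℚ K = 2)
    {D : ℕ} (hD : D % 8 = 7) {s : K} (hs : s ^ 2 = -D) {x y : ℤ} (hx : x % 8 = 3 ∨ x % 8 = 5) {k : ℕ}
    (hk : 2 ≤ k) (hxy : x ^ 2 + D * y ^ 2 = 4 ^ (k + 1)) {e : ℤ} (he : e = 1 ∨ e = -1) (a b : K) :
    (x + y * s) / 2 ≠ e * (a ^ 2 - 2 * b ^ 2) := by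
  intro h
  obtain ⟨ρ, hρ⟩ := Padic.exists_sq_eq_of_emod_eight (m := -D) (by omega)
  push_cast at hρ
  have hD' : ∀ z : ℚ, z ^ 2 ≠ -D := Rat.sq_ne_of_neg (by
    have : (0 : ℚ) < D := by exact_mod_cast (by omega : 0 < D)
    linarith)
  have hs' : s ^ 2 = algebraMap ℚ K (-D) := by rw [hs, map_neg, map_natCast]
  obtain ⟨φ, hφ⟩ := exists_ringHom_of_sq_eq h2 hD' hs' (ρ := ρ) (by simpa using hρ)
  obtain ⟨ψ, hψ⟩ := exists_ringHom_of_sq_eq h2 hD' hs' (ρ := -ρ) (by simpa using hρ)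
  have hφ' := congrArg φ h
  have hψ' := congrArg ψ h
  simp only [map_div₀, map_add, map_sub, map_mul, map_pow, map_intCast, map_ofNat, hφ, hψ] at hφ' hψ'
  have hxy' : (x : ℚ_[2]) ^ 2 + D * y ^ 2 = 4 ^ (k + 1) := by exact_mod_cast congrArg (Int.cast (R := ℚ_[2])) hxy
  obtain ⟨v, hv, hvx⟩ := Padic.exists_toZModPow_eq (W := (x + y * ρ) / 2) (W' := (x + y * -ρ) / 2)
    (x := x) (by omega) hk (by ring) (by linear_combination hxy' / 4 - y ^ 2 * hρ / 4)
  have hv8 : PadicInt.toZModPow 3 v = 3 ∨ PadicInt.toZModPow 3 v = 5 := by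
    rw [hvx]
    refine hx.imp (fun h => ?_) fun h => ?_
    · exact_mod_cast (ZMod.intCast_eq_intCast_iff x 3 (2 ^ 3)).2 (by exact_mod_cast h)
    · exact_mod_cast (ZMod.intCast_eq_intCast_iff x 5 (2 ^ 3)).2 (by exact_mod_cast h)
  rcases hv with hv | hv
  · exact Padic.ne_sq_sub_two_mul_sq hv8 he _ _ (hv.trans hφ')
  · exact Padic.ne_sq_sub_two_mul_sq hv8 he _ _ (hv.trans hψ')

end DyadicNormForm

section Descent

theorem Int.exists_eq_sq_of_isCoprime {a b c : ℤ} (hab : IsCoprime a b) (ha : 0 < a)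
    (h : a * b = c ^ 2) : ∃ d, a = d ^ 2 := by
  obtain ⟨d, hd | hd⟩ := Int.sq_of_isCoprime hab h
  · exact ⟨d, hd⟩
  · nlinarith [sq_nonneg d]

theorem Int.sq_emod_eight_of_odd {a : ℤ} (h : a % 2 = 1) : a ^ 2 % 8 = 1 := by
  have : a % 8 = 1 ∨ a % 8 = 3 ∨ a % 8 = 5 ∨ a % 8 = 7 := by omega
  rw [sq, Int.mul_emod]
  rcases this with h | h | h | h <;> rw [h] <;> norm_num

theorem emod_eight_eq_of_sq_add_mul_sq {p q : ℕ} (hp : p.Prime) (hq : q.Prime) (hp8 : p % 8 = 5)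
    {x y : ℤ} (hx : x % 2 = 1) {k : ℕ} (hk : Odd k) (hk2 : 2 ≤ k)
    (h : x ^ 2 + (p * q : ℕ) * y ^ 2 = 4 ^ (k + 1)) : x % 8 = 3 ∨ x % 8 = 5 := by
  obtain ⟨m, hm⟩ : ∃ m : ℤ, (2 : ℤ) ^ (k + 1) = 8 * m :=
    ⟨2 ^ (k - 2), by rw [show (8 : ℤ) = 2 ^ 3 by norm_num, ← pow_add]; congr 1; omega⟩
  have hsq : (4 : ℤ) ^ (k + 1) = (8 * m) ^ 2 := by
    rw [← hm, ← pow_mul, mul_comm, pow_mul]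
    norm_num
  have hp' := Nat.prime_iff_prime_int.1 hp
  have hq' := Nat.prime_iff_prime_int.1 hq
  have hp0 : (0 : ℤ) < p := by exact_mod_cast hp.pos
  have hq0 : (0 : ℤ) < q := by exact_mod_cast hq.pos
  have hprod : (8 * m - x) * (8 * m + x) = p * (q * y ^ 2) := by
    push_cast at h
    linear_combination -h - hsq
  have hy : y ≠ 0 := by
    rintro rfl
    have h1 : x ^ 2 % 2 = 1 := by
      rw [sq, Int.mul_emod, hx]
      norm_num
    rw [hsq] at h
    have h2 : x ^ 2 = 2 * (32 * m ^ 2) := by linear_combination h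
    omega
  have hy2 : 0 < y ^ 2 := by positivity
  wlog hA : (p : ℤ) ∣ 8 * m - x generalizing x
  · have := this (x := -x) (by omega) (by linear_combination h) (by linear_combination hprod) (by
      rcases hp'.dvd_mul.1 (Dvd.intro _ hprod.symm) with h | h
      · exact absurd h hA
      · rwa [sub_neg_eq_add])
    omega
  have hmpos : 0 < 8 * m := by rw [← hm]; positivity
  have hAB : 0 < (8 * m - x) * (8 * m + x) := by rw [hprod]; positivity
  have hA0 : 0 < 8 * m - x := by
    by_contra hcon
    nlinarith
  have hB0 : 0 < 8 * m + x := pos_of_mul_pos_right hAB hA0.le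
  have hcop : IsCoprime (8 * m - x) (8 * m + x) := by
    have h1 : IsCoprime (8 * m - x) (2 ^ (k + 2)) := by
      refine IsCoprime.pow_right ?_
      exact ⟨1, -((8 * m - x) / 2), by omega⟩
    have e : 8 * m + x = 2 ^ (k + 2) + (8 * m - x) * (-1) := by
      rw [pow_succ, hm]
      ring
    rw [e]
    exact h1.add_mul_left_right (-1)
  obtain ⟨A, hA⟩ := hA
  have hprod2 : A * (8 * m + x) = q * y ^ 2 := by
    apply mul_left_cancel₀ hp0.ne'
    rw [← hprod, hA]
    ring
  have hA1 : 0 < A := by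
    rw [hA] at hA0
    exact pos_of_mul_pos_right hA0 hp0.le
  have hcop2 : IsCoprime A (8 * m + x) := by
    rw [hA] at hcop
    exact hcop.of_mul_left_right
  rcases hq'.dvd_mul.1 (Dvd.intro _ hprod2.symm) with ⟨A', rfl⟩ | ⟨B', hB⟩
  · have hprod3 : (8 * m + x) * A' = y ^ 2 := by
      apply mul_left_cancel₀ hq0.ne'
      rw [← hprod2]
      ring
    obtain ⟨d, hd⟩ := Int.exists_eq_sq_of_isCoprime hcop2.of_mul_left_right.symm hB0 hprod3
    exfalso
    obtain ⟨j, rfl⟩ := hk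
    have := Fact.mk hp
    have e : (d : ZMod p) ^ 2 = 2 * (2 ^ (j + 1)) ^ 2 := by
      have e1 : d ^ 2 + p * (q * A') = 2 * (2 ^ (j + 1)) ^ 2 := by
        rw [← hd, ← hA, ← pow_mul, show (j + 1) * 2 = 2 * j + 1 + 1 by ring, hm]
        ring
      simpa using congrArg (Int.cast (R := ZMod p)) e1
    have h2 : (2 : ZMod p) ≠ 0 := fun h0 => by
      have := (ZMod.natCast_eq_zero_iff 2 p).1 (by exact_mod_cast h0)
      have := Nat.le_of_dvd two_pos this
      omega
    have hsq2 : IsSquare (2 : ZMod p) := ⟨d / 2 ^ (j + 1), by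
      field_simp
      linear_combination -e⟩
    rw [ZMod.exists_sq_eq_two_iff (by omega)] at hsq2
    omega
  · left
    have hprod3 : A * B' = y ^ 2 := by
      apply mul_left_cancel₀ hq0.ne'
      rw [← hprod2, hB]
      ring
    rw [hB] at hcop2
    obtain ⟨d, rfl⟩ := Int.exists_eq_sq_of_isCoprime hcop2.of_mul_right_right hA1 hprod3
    have hd : d % 2 = 1 := by
      by_contra hd
      obtain ⟨c, rfl⟩ : 2 ∣ d := by omega
      have : x = 2 * (4 * m - p * (2 * c ^ 2)) := by linear_combination -hA
      omega
    have h1 := Int.sq_emod_eight_of_odd hd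
    have h2 : (p : ℤ) * d ^ 2 % 8 = 5 := by
      rw [Int.mul_emod, h1]
      omega
    omega

end Descent

section ImaginaryQuadratic

open NumberField Module

variable {K : Type*} [Field K] [NumberField K] {D : ℕ} {s : K}

theorem exists_eq_add_mul_sqrt_div_two (h2 : finrank ℚ K = 2) (hD : Squarefree (D : ℤ))
    (hs : s ^ 2 = -D) (z : 𝓞 K) : ∃ x y : ℤ, (z : K) = (x + y * s) / 2 ∧
      x ^ 2 + D * y ^ 2 = 4 * Algebra.norm ℤ z := by
  have hD0 : (0 : ℤ) < D := lt_of_le_of_ne (by positivity) hD.ne_zero.symm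
  have hD' : ∀ z : ℚ, z ^ 2 ≠ -D := Rat.sq_ne_of_neg (by
    have : (0 : ℚ) < D := by exact_mod_cast hD0
    linarith)
  have hs' : s ^ 2 = algebraMap ℚ K (-D) := by rw [hs, map_neg, map_natCast]
  obtain ⟨a, b, hab, hN⟩ := norm_int_mul_norm_int h2 (by exact_mod_cast hD0) hs z
  obtain ⟨φ, hφ⟩ := exists_ringHom_of_sq_eq h2 hD' hs' (ρ := -s) (by rw [neg_sq, hs'])
  have hint : IsIntegral ℤ (2 * a) := by
    have h1 : IsIntegral ℤ ((z : K) + φ z) :=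
      (RingOfIntegers.isIntegral_coe z).add
        ((RingOfIntegers.isIntegral_coe z).map (φ.restrictScalars ℤ))
    have h3 : (z : K) + φ z = algebraMap ℚ K (2 * a) := by
      rw [hab, map_add, map_mul, AlgHom.commutes, AlgHom.commutes, hφ, map_mul, map_ofNat]
      ring
    rw [h3] at h1
    exact (isIntegral_algebraMap_iff (algebraMap ℚ K).injective).1 h1
  obtain ⟨x, hx⟩ := IsIntegrallyClosed.isIntegral_iff.1 hint
  rw [eq_intCast] at hx
  set M : ℤ := 4 * Algebra.norm ℤ z - x ^ 2 with hM
  have hM' : (M : ℚ) = D * (2 * b) ^ 2 := by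
    rw [hM]
    push_cast
    rw [hN, hx]
    ring
  obtain ⟨k, hk⟩ : IsSquare (D * M : ℤ) := by
    rw [← Rat.isSquare_intCast_iff]
    refine ⟨D * (2 * b), ?_⟩
    push_cast
    rw [hM']
    ring
  obtain ⟨j, rfl⟩ : (D : ℤ) ∣ k := by
    refine hD.isRadical 2 k ?_
    rw [sq, ← hk]
    exact dvd_mul_right _ _
  have hMj : M = D * j ^ 2 := by
    apply mul_left_cancel₀ hD0.ne'
    rw [hk]
    ring
  have hbj : (2 * b) ^ 2 = (j : ℚ) ^ 2 := by
    have : (D : ℚ) ≠ 0 := by exact_mod_cast hD0.ne'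
    apply mul_left_cancel₀ this
    rw [← hM', hMj]
    push_cast
    ring
  have hxK : (x : K) = 2 * algebraMap ℚ K a := by
    rw [← map_intCast (algebraMap ℚ K), hx, map_mul, map_ofNat]
  rcases sq_eq_sq_iff_eq_or_eq_neg.1 hbj with h | h
  · have hyK : (j : K) = 2 * algebraMap ℚ K b := by
      rw [← map_intCast (algebraMap ℚ K), ← h, map_mul, map_ofNat]
    refine ⟨x, j, ?_, by linear_combination hM - hMj⟩
    rw [hab, hxK, hyK]
    ring
  · have hyK : ((-j : ℤ) : K) = 2 * algebraMap ℚ K b := by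
      rw [← map_intCast (algebraMap ℚ K), Int.cast_neg, ← h, map_mul, map_ofNat]
    refine ⟨x, -j, ?_, by linear_combination hM - hMj⟩
    rw [hab, hxK, hyK]
    ring

theorem norm_int_nonneg (h2 : finrank ℚ K = 2) (hD : Squarefree (D : ℤ)) (hs : s ^ 2 = -D) (z : 𝓞 K) :
    0 ≤ Algebra.norm ℤ z := by
  obtain ⟨x, y, -, h⟩ := exists_eq_add_mul_sqrt_div_two h2 hD hs z
  have : 0 ≤ x ^ 2 + D * y ^ 2 := by positivity
  omega

theorem coe_absNorm_span_singleton (h2 : finrank ℚ K = 2) (hD : Squarefree (D : ℤ)) (hs : s ^ 2 = -D)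
    (z : 𝓞 K) : (Ideal.absNorm (Ideal.span {z}) : ℤ) = Algebra.norm ℤ z := by
  rw [Ideal.absNorm_span_singleton, Int.natAbs_of_nonneg (norm_int_nonneg h2 hD hs z)]

theorem units_eq_one_or_neg_one (h2 : finrank ℚ K = 2) (hD : Squarefree (D : ℤ)) (hD4 : 4 < D)
    (hs : s ^ 2 = -D) (u : (𝓞 K)ˣ) : ((u : 𝓞 K) : K) = 1 ∨ ((u : 𝓞 K) : K) = -1 := by
  obtain ⟨x, y, hu, h⟩ := exists_eq_add_mul_sqrt_div_two h2 hD hs u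
  have hN : Algebra.norm ℤ (u : 𝓞 K) = 1 := by
    rw [← coe_absNorm_span_singleton h2 hD hs, Ideal.span_singleton_eq_top.2 u.isUnit,
      Ideal.absNorm_top, Nat.cast_one]
  rw [hN] at h
  have hD4' : (4 : ℤ) < D := by exact_mod_cast hD4
  have hy : y = 0 := by
    by_contra hy
    have : 0 < y ^ 2 := by positivity
    nlinarith [sq_nonneg x]
  subst hy
  have hx : (x - 2) * (x + 2) = 0 := by linear_combination h
  rcases mul_eq_zero.1 hx with hx | hx
  · left
    rw [hu, show x = 2 by omega]
    norm_num
  · right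
    rw [hu, show x = -2 by omega]
    norm_num

end ImaginaryQuadratic

section SplitTwo

theorem Ideal.span_pair_mul_span_pair_one_sub {A : Type*} [CommRing A] {θ m : A}
    (hθ : θ * (1 - θ) = 2 * m) :
    Ideal.span {2, θ} * Ideal.span {2, 1 - θ} = Ideal.span {2} := by
  rw [Ideal.span_pair_mul_span_pair]
  apply le_antisymm
  · rw [Ideal.span_le]
    rintro z (rfl | rfl | rfl | rfl)
    · exact Ideal.mem_span_singleton.2 ⟨2, rfl⟩
    · exact Ideal.mem_span_singleton.2 ⟨1 - θ, rfl⟩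
    · exact Ideal.mem_span_singleton.2 ⟨θ, mul_comm _ _⟩
    · exact Ideal.mem_span_singleton.2 ⟨m, hθ⟩
  · rw [Ideal.span_singleton_le_iff_mem]
    have h1 : (2 * (1 - θ) : A) ∈ Ideal.span {2 * 2, 2 * (1 - θ), θ * 2, θ * (1 - θ)} :=
      Ideal.subset_span (by simp)
    have h2 : θ * 2 ∈ Ideal.span {2 * 2, 2 * (1 - θ), θ * 2, θ * (1 - θ)} :=
      Ideal.subset_span (by simp)
    have := add_mem h1 h2
    convert this using 1
    ring

theorem Ideal.isCoprime_span_pair_one_sub {A : Type*} [CommRing A] (θ : A) :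
    IsCoprime (Ideal.span {2, θ}) (Ideal.span {2, 1 - θ}) := by
  rw [Ideal.isCoprime_iff_exists]
  exact ⟨θ, Ideal.subset_span (by simp), 1 - θ, Ideal.subset_span (by simp), by ring⟩

open NumberField Module

variable {K : Type*} [Field K] [NumberField K] {D : ℕ} {s : K}

theorem not_two_dvd_of_coe_eq (h2 : finrank ℚ K = 2) (hD : Squarefree (D : ℤ)) (hs : s ^ 2 = -D)
    {θ : 𝓞 K} (hθ : algebraMap (𝓞 K) K θ = (1 + s) / 2) : ¬ 2 ∣ θ := by
  rintro ⟨z, rfl⟩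
  obtain ⟨x, y, hz, -⟩ := exists_eq_add_mul_sqrt_div_two h2 hD hs z
  have hD' : ∀ z : ℚ, z ^ 2 ≠ -D := Rat.sq_ne_of_neg (by
    have : (0 : ℚ) < D := by exact_mod_cast Nat.pos_of_ne_zero (by exact_mod_cast hD.ne_zero)
    linarith)
  have hs' : s ^ 2 = algebraMap ℚ K (-D) := by rw [hs, map_neg, map_natCast]
  have h := (eq_and_eq_of_add_mul_eq hD' hs' (a := x) (b := y) (a' := 1 / 2) (b' := 1 / 2) (by
    rw [RingOfIntegers.coe_eq_algebraMap] at hz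
    rw [map_mul, map_ofNat, hz] at hθ
    simp only [map_intCast, map_div₀, map_one, map_ofNat]
    linear_combination hθ)).1
  have h' : (2 * x : ℚ) = 1 := by rw [h]; norm_num
  have : 2 * x = 1 := by exact_mod_cast h'
  omega

variable {θ : 𝓞 K}

theorem exists_mul_one_sub_eq (hD8 : D % 8 = 7) (hs : s ^ 2 = -D) (hθ : algebraMap (𝓞 K) K θ = (1 + s) / 2) :
    ∃ m : ℤ, θ * (1 - θ) = 2 * m := by
  refine ⟨(D + 1) / 8, FaithfulSMul.algebraMap_injective (𝓞 K) K ?_⟩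
  rw [map_mul, map_mul, map_sub, map_one, map_ofNat, map_intCast, hθ]
  have h : ((8 * ((D + 1) / 8) : ℤ) : K) = ((D + 1 : ℤ) : K) := by
    congr 1
    omega
  push_cast at h ⊢
  linear_combination -hs / 4 - h / 4

theorem absNorm_span_two_pair (h2 : finrank ℚ K = 2) (hD : Squarefree (D : ℤ)) (hD8 : D % 8 = 7)
    (hs : s ^ 2 = -D) (hθ : algebraMap (𝓞 K) K θ = (1 + s) / 2) :
    Ideal.absNorm (Ideal.span {2, θ}) = 2 ∧ Ideal.absNorm (Ideal.span {2, 1 - θ}) = 2 := by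
  obtain ⟨m, hm⟩ := exists_mul_one_sub_eq hD8 hs hθ
  have hprod := Ideal.span_pair_mul_span_pair_one_sub hm
  have h1 : Ideal.absNorm (Ideal.span {2, θ}) ≠ 1 := by
    rw [Ne, Ideal.absNorm_eq_one_iff]
    intro h
    rw [h, Ideal.top_mul] at hprod
    refine not_two_dvd_of_coe_eq h2 hD (s := -s) (by rw [neg_sq, hs]) (θ := 1 - θ)
      (by rw [map_sub, map_one, hθ]; ring) ?_
    rw [← Ideal.mem_span_singleton, ← hprod]
    exact Ideal.subset_span (by simp)
  have h1' : Ideal.absNorm (Ideal.span {2, 1 - θ}) ≠ 1 := by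
    rw [Ne, Ideal.absNorm_eq_one_iff]
    intro h
    rw [h, Ideal.mul_top] at hprod
    refine not_two_dvd_of_coe_eq h2 hD hs hθ ?_
    rw [← Ideal.mem_span_singleton, ← hprod]
    exact Ideal.subset_span (by simp)
  have hN := congrArg Ideal.absNorm hprod
  have h4 := absNorm_span_natCast (K := K) 2
  rw [h2, Nat.cast_ofNat] at h4
  rw [map_mul, h4] at hN
  generalize Ideal.absNorm (Ideal.span {2, θ}) = a at *
  generalize Ideal.absNorm (Ideal.span {2, 1 - θ}) = b at *
  have ha : a ≤ 4 := Nat.le_of_dvd (by norm_num) (Dvd.intro _ hN)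
  interval_cases a <;> omega

theorem exists_odd_of_span_eq_pow (h2 : finrank ℚ K = 2) (hD : Squarefree (D : ℤ)) (hD8 : D % 8 = 7)
    (hs : s ^ 2 = -D) (hθ : algebraMap (𝓞 K) K θ = (1 + s) / 2) {γ : 𝓞 K} {k : ℕ} (hk : 0 < k)
    (hγ : Ideal.span {γ} = Ideal.span {2, θ} ^ (2 * k)) :
    ∃ x y : ℤ, algebraMap (𝓞 K) K γ = (x + y * s) / 2 ∧ x % 2 = 1 ∧ x ^ 2 + D * y ^ 2 = 4 ^ (k + 1) := by
  obtain ⟨x, y, hxy, h⟩ := exists_eq_add_mul_sqrt_div_two h2 hD hs γ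
  obtain ⟨hN, hN'⟩ := absNorm_span_two_pair h2 hD hD8 hs hθ
  rw [← coe_absNorm_span_singleton h2 hD hs, hγ, map_pow, hN, pow_mul] at h
  have h4 : x ^ 2 + D * y ^ 2 = 4 ^ (k + 1) := by
    rw [h, pow_succ]
    push_cast
    ring
  rw [RingOfIntegers.coe_eq_algebraMap] at hxy
  refine ⟨x, y, hxy, ?_, h4⟩
  by_contra hx
  obtain ⟨u, rfl⟩ : 2 ∣ x := by omega
  have hDodd : Odd (D : ℤ) := by
    rw [Int.odd_iff]
    omega
  have hy : Even y := by
    have h5 : Even ((2 * u) ^ 2 + D * y ^ 2) := by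
      rw [h4, pow_succ]
      exact (by decide : Even (4 : ℤ)).mul_left _
    rw [Int.even_add, Int.even_mul, Int.even_pow, Int.even_pow] at h5
    have := h5.1 ⟨even_two_mul u, two_ne_zero⟩
    rcases this with h | h
    · exact absurd h (Int.not_even_iff_odd.2 hDodd)
    · exact h.1
  obtain ⟨v, rfl⟩ := even_iff_two_dvd.1 hy
  have huv : Even (u - v) := by
    have h5 : u ^ 2 + D * v ^ 2 = 4 ^ k := by
      have h5 : (4 : ℤ) ^ (k + 1) = 4 ^ k * 4 := pow_succ _ _
      linarith
    have h6 : Even (u ^ 2 + D * v ^ 2) := by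
      rw [h5]
      exact (by decide : Even (4 : ℤ)).pow_of_ne_zero hk.ne'
    rw [Int.even_add, Int.even_mul, Int.even_pow, Int.even_pow] at h6
    rw [Int.even_sub]
    have := Int.not_even_iff_odd.2 hDodd
    tauto
  obtain ⟨c, hc⟩ := even_iff_two_dvd.1 huv
  have hdvd : 2 ∣ γ := by
    refine ⟨c + v * θ, FaithfulSMul.algebraMap_injective (𝓞 K) K ?_⟩
    have hc' : (u : K) - v = 2 * c := by exact_mod_cast congrArg (Int.cast (R := K)) hc
    rw [map_mul, map_add, map_mul, map_ofNat, map_intCast, map_intCast, hθ, hxy]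
    push_cast
    linear_combination hc'
  obtain ⟨m, hm⟩ := exists_mul_one_sub_eq hD8 hs hθ
  have hprod := Ideal.span_pair_mul_span_pair_one_sub hm
  have hdvd' : Ideal.span {2, 1 - θ} ∣ Ideal.span {2, θ} ^ (2 * k) := by
    rw [← hγ]
    refine (Dvd.intro_left _ hprod).trans ?_
    rwa [Ideal.dvd_span_singleton, Ideal.mem_span_singleton]
  have hunit := ((Ideal.isCoprime_span_pair_one_sub θ).pow_left (m := 2 * k)).isUnit_of_dvd' hdvd' dvd_rfl
  rw [Ideal.isUnit_iff.1 hunit, Ideal.absNorm_top] at hN'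
  omega

theorem span_pow_mul_pow_ne {p q : ℕ} (hp : p.Prime) (hq : q.Prime) (hp8 : p % 8 = 5)
    (hq8 : q % 8 = 3) (h2 : finrank ℚ K = 2) (hs : s ^ 2 = -(p * q)) (hθ : algebraMap (𝓞 K) K θ = (1 + s) / 2)
    {γ : 𝓞 K} {k : ℕ} (hk : Odd k) (hk2 : 2 ≤ k)
    (hγ : Ideal.span {γ} = Ideal.span {2, θ} ^ (2 * k)) {X Y C : 𝓞 K} (hX : X ≠ 0) {a b : K}
    (hXY : algebraMap (𝓞 K) K Y = algebraMap (𝓞 K) K X * (a ^ 2 - 2 * b ^ 2)) :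
    Ideal.span {X} ^ k * Ideal.span {γ} ^ k ≠ Ideal.span {Y} ^ k * Ideal.span {C} ^ 2 := by
  intro h
  have hne : p ≠ q := by rintro rfl; omega
  have hD : Squarefree ((p * q : ℕ) : ℤ) := by
    rw [Int.squarefree_natCast, Nat.squarefree_mul ((Nat.coprime_primes hp hq).2 hne)]
    exact ⟨hp.squarefree, hq.squarefree⟩
  have hD8 : p * q % 8 = 7 := by rw [Nat.mul_mod, hp8, hq8]
  have hD4 : 4 < p * q := by
    have := Nat.mod_le (p * q) 8
    omega
  have hs' : s ^ 2 = -((p * q : ℕ) : K) := by rw [hs, Nat.cast_mul]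
  obtain ⟨x, y, hxy, hx, h4⟩ := exists_odd_of_span_eq_pow h2 hD hD8 hs' hθ (by omega) hγ
  have hx8 := emod_eight_eq_of_sq_add_mul_sq hp hq hp8 hx hk hk2 h4
  simp only [Ideal.span_singleton_pow, Ideal.span_singleton_mul_span_singleton,
    Ideal.span_singleton_eq_span_singleton] at h
  obtain ⟨u, hu⟩ := h.symm
  obtain ⟨e, he, hue⟩ : ∃ e : ℤ, (e = 1 ∨ e = -1) ∧ algebraMap (𝓞 K) K u = e := by
    rcases units_eq_one_or_neg_one h2 hD hD4 hs' u with h | h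
    · exact ⟨1, Or.inl rfl, by simp [h]⟩
    · exact ⟨-1, Or.inr rfl, by simp [h]⟩
  have hu' := congrArg (algebraMap (𝓞 K) K) hu
  simp only [map_mul, map_pow, hue] at hu'
  rw [hXY] at hu'
  have hX' : algebraMap (𝓞 K) K X ≠ 0 := by simpa using hX
  have hγ0 : algebraMap (𝓞 K) K γ ≠ 0 := by
    intro h0
    have hγ0 : γ = 0 := by simpa using h0
    have := congrArg Ideal.absNorm hγ
    rw [hγ0, map_pow, (absNorm_span_two_pair h2 hD hD8 hs' hθ).1] at this
    simp only [Ideal.span_singleton_zero, Ideal.absNorm_bot] at this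
    exact pow_ne_zero _ two_ne_zero this.symm
  obtain ⟨j, rfl⟩ := hk
  set N := a ^ 2 - 2 * b ^ 2 with hN
  set g := algebraMap (𝓞 K) K γ
  set c := algebraMap (𝓞 K) K C
  have key : g = e * ((a * (N ^ j * c / g ^ j)) ^ 2 - 2 * (b * (N ^ j * c / g ^ j)) ^ 2) := by
    have e1 : g ^ (2 * j + 1) = e * N ^ (2 * j + 1) * c ^ 2 := by
      apply mul_left_cancel₀ (pow_ne_zero (2 * j + 1) hX')
      rw [← hu', mul_pow]
      ring
    have e2 : (a * (N ^ j * c / g ^ j)) ^ 2 - 2 * (b * (N ^ j * c / g ^ j)) ^ 2 =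
        N ^ (2 * j + 1) * c ^ 2 / g ^ (2 * j) := by
      have : N ^ (2 * j + 1) = N ^ (2 * j) * (a ^ 2 - 2 * b ^ 2) := by rw [pow_succ, ← hN]
      rw [this, mul_pow, mul_pow, div_pow, mul_pow, ← pow_mul, ← pow_mul, mul_comm j 2]
      generalize N ^ (2 * j) = n
      generalize g ^ (2 * j) = m
      ring
    rw [e2, ← mul_div_assoc, ← mul_assoc, ← e1, eq_div_iff (pow_ne_zero _ hγ0),
      pow_succ']
  rw [show g = (x + y * s) / 2 from hxy] at key
  exact ne_sq_sub_two_mul_sq_of_sqrt_neg h2 hD8 hs' hx8 hk2 h4 he _ _ key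

end SplitTwo

section ClassGroupBounds

open NumberField Module

variable {K₁ K₂ K₃ L : Type*} [Field K₁] [Field K₂] [Field K₃] [Field L]
  [NumberField K₁] [NumberField K₂] [NumberField K₃] [Algebra K₁ K₂] [Algebra K₂ K₃]
  {p q : ℕ} [Fact p.Prime] [Fact q.Prime]

theorem odd_card_classGroup_sqrt_neg_prime (hp8 : p % 8 = 5)
    (hq8 : q % 8 = 3) (hpq : ¬ IsSquare (p : ZMod q)) (h1 : finrank ℚ K₁ = 2) {s : K₁} (hs : s ^ 2 = -2)
    (h2 : finrank K₁ K₂ = 2) {r : K₂} (hr : r ^ 2 = p) (h3 : finrank K₂ K₃ = 2) {t : K₃}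
    (ht : t ^ 2 = -q) : Odd (Nat.card (ClassGroup (𝓞 K₃))) := by
  have hq : q.Prime := Fact.out
  have hrank : Units.rank K₃ + 1 = 4 := rank_add_one_eq (x := t) (m := -q)
    (by have := hq.pos; omega) (by push_cast; exact ht) (finrank_rat_eq (finrank_rat_eq h1 h2) h3)
  exact odd_card_of_card_ker_sq (Nat.dvd_one.1 (card_classGroup_two_torsion_dvd (m := 0) hrank
    (relIndex_selmerTwo_sqrt_neg_prime hp8 hq8 hpq h1 hs h2 hr h3 ht) rfl))

variable [NumberField L] [Algebra K₃ L]

theorem card_classGroup_two_torsion_dvd_two (hp8 : p % 8 = 5)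
    (hq8 : q % 8 = 3) (hpq : ¬ IsSquare (p : ZMod q)) (h1 : finrank ℚ K₁ = 2) {s : K₁} (hs : s ^ 2 = -2)
    (h2 : finrank K₁ K₂ = 2) {r : K₂} (hr : r ^ 2 = p) (h3 : finrank K₂ K₃ = 2) {t : K₃}
    (ht : t ^ 2 = -q) (h4 : finrank K₃ L = 2) {i : L} (hi : i ^ 2 = -1) :
    Nat.card (powMonoidHom 2 : ClassGroup (𝓞 L) →* ClassGroup (𝓞 L)).ker ∣ 2 := by
  have hrank : Units.rank L + 1 = 8 := rank_add_one_eq (x := i) (m := -1)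
    (by norm_num) (by push_cast; exact hi)
    (finrank_rat_eq (finrank_rat_eq (finrank_rat_eq h1 h2) h3) h4)
  exact card_classGroup_two_torsion_dvd (m := 1) hrank
    (relIndex_selmerTwo_i hp8 hq8 hpq h1 hs h2 hr h3 ht h4 hi) rfl

end ClassGroupBounds

section NormForm

open Module IntermediateField

variable {K L : Type*} [Field K] [Field L] [Algebra K L] {d : K} {r : L}

theorem finrank_adjoin_eq_two (hd : ∀ z : K, z ^ 2 ≠ d) (hr : r ^ 2 = algebraMap K L d) :
    finrank K K⟮r⟯ = 2 := by
  have hi : IsIntegral K r := IsIntegral.of_pow two_pos (hr ▸ isIntegral_algebraMap)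
  have hm : minpoly K r = Polynomial.X ^ 2 - Polynomial.C d := by
    symm
    apply minpoly.eq_of_irreducible_of_monic
    · exact X_pow_sub_C_irreducible_of_prime Nat.prime_two hd
    · simp [hr]
    · exact Polynomial.monic_X_pow_sub_C d two_ne_zero
  rw [adjoin.finrank hi, hm, Polynomial.natDegree_X_pow_sub_C]

theorem gen_sq_eq (hr : r ^ 2 = algebraMap K L d) :
    (AdjoinSimple.gen K r) ^ 2 = algebraMap K K⟮r⟯ d :=
  Subtype.ext (by simpa using hr)

/-- Norms from a finite extension containing `√d` are norms from `K(√d)`. -/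
theorem exists_norm_eq_sq_sub_mul_sq [FiniteDimensional K L] (hd : ∀ z : K, z ^ 2 ≠ d)
    (hr : r ^ 2 = algebraMap K L d) (z : L) : ∃ a b : K, Algebra.norm K z = a ^ 2 - d * b ^ 2 := by
  have hM := finrank_adjoin_eq_two hd hr
  have hr' := gen_sq_eq hr
  obtain ⟨a, b, hab⟩ := exists_eq_add_mul hM hd hr' (Algebra.norm K⟮r⟯ z)
  exact ⟨a, b, by rw [← Algebra.norm_norm (S := K⟮r⟯), hab, norm_add_mul hM hd hr']⟩

end NormForm

section IdealPowers

theorem associated_one_add_pow_four {A : Type*} [CommRing A] {z w : A} (hz : z ^ 2 + 1 = w * z) (hw : w ^ 2 = 2) :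
    Associated ((1 + z) ^ 4) 2 := by
  have h4 : z ^ 4 = -1 := by
    linear_combination (z ^ 2 + 1 + w * z) * hz + z ^ 2 * hw
  have e : (1 + z) ^ 4 = 2 * (z ^ 2 * (1 + w) ^ 2) := by
    have h2 : (1 + z) ^ 2 = z * w * (1 + w) := by linear_combination hz + (-z) * hw
    linear_combination ((1 + z) ^ 2 + z * w * (1 + w)) * h2 + z ^ 2 * (1 + w) ^ 2 * hw
  have hu : IsUnit (z ^ 2 * (1 + w) ^ 2) := by
    refine IsUnit.of_mul_eq_one (-(z ^ 2) * (w - 1) ^ 2) ?_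
    linear_combination (-(w ^ 2 - 1) ^ 2) * h4 + (w ^ 2) * hw
  rw [e]
  exact associated_mul_unit_left _ _ hu

variable {A : Type*} [CommRing A] [IsDedekindDomain A]

theorem Ideal.exists_span_pair_eq_pow {θ m : A} (hθ : θ * (1 - θ) = 2 * m) {l : A} {n : ℕ}
    (hl : Associated (l ^ n) 2) : ∃ J : Ideal A, Ideal.span {2, θ} = J ^ n := by
  refine exists_eq_pow_of_mul_eq_pow_of_coprime (b := Ideal.span {2, 1 - θ}) (c := Ideal.span {l})
    (Ideal.isCoprime_span_pair_one_sub θ) ?_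
  rw [Ideal.span_pair_mul_span_pair_one_sub hθ, Ideal.span_singleton_pow,
    Ideal.span_singleton_eq_span_singleton]
  exact hl.symm

theorem Ideal.eq_of_pow_eq_pow {n : ℕ} (hn : n ≠ 0) {I J : Ideal A} (h : I ^ n = J ^ n) : I = J :=
  pow_left_injective hn h

end IdealPowers

section NormArgument

open NumberField Module

theorem sq_ne_two_of_sqrt_neg {K : Type*} [Field K] [NumberField K] {p q : ℕ} (hp : p.Prime)
    (hq : q.Prime) (h2 : finrank ℚ K = 2) {s : K} (hs : s ^ 2 = -(p * q)) (z : K) : z ^ 2 ≠ 2 := by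
  have hpq : (0 : ℚ) < p * q := by exact_mod_cast mul_pos hp.pos hq.pos
  have := forall_sq_ne_algebraMap h2 (d := -(p * q : ℚ)) (Rat.sq_ne_of_neg (by linarith)) (r := s)
    (by simp [hs]) (x := 2) (fun z => ?_) (Rat.sq_ne_of_neg (by linarith)) z
  · simpa using this
  · simpa using Rat.sq_ne_prime_mul Nat.prime_two (a := 1) (by norm_num) z

theorem exists_pow_card_classGroup_eq_span {K : Type*} [Field K] [NumberField K] {I : Ideal (𝓞 K)}
    (hI : I ≠ ⊥) : ∃ x : 𝓞 K, I ^ Nat.card (ClassGroup (𝓞 K)) = Ideal.span {x} := by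
  have h : ClassGroup.mk0 ((⟨I, mem_nonZeroDivisors_iff_ne_zero.2 hI⟩ : nonZeroDivisors (Ideal (𝓞 K))) ^
      Nat.card (ClassGroup (𝓞 K))) = 1 := by
    rw [map_pow, pow_card_eq_one']
  rw [ClassGroup.mk0_eq_one_iff] at h
  obtain ⟨x, hx⟩ := h
  exact ⟨x, by simpa using hx⟩

theorem map_span_two_pair {K L : Type*} [Field K] [Field L] [Algebra K L] (θ : 𝓞 K) : Ideal.map (algebraMap (𝓞 K) (𝓞 L)) (Ideal.span {2, θ}) =
    Ideal.span {2, algebraMap (𝓞 K) (𝓞 L) θ} := by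
  rw [Ideal.map_span, Set.image_pair, map_ofNat]

variable {K M L : Type*} [Field K] [Field M] [Field L] [NumberField L] [Algebra K L]

theorem exists_span_two_pair_pow {θ : 𝓞 K} {m : 𝓞 K} (hθ : θ * (1 - θ) = 2 * m) {l : 𝓞 L} {n : ℕ}
    (hl : Associated (l ^ n) 2) :
    ∃ J : Ideal (𝓞 L), Ideal.map (algebraMap (𝓞 K) (𝓞 L)) (Ideal.span {2, θ}) = J ^ n := by
  have := congrArg (algebraMap (𝓞 K) (𝓞 L)) hθ
  rw [map_mul, map_sub, map_one, map_mul, map_ofNat] at this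
  rw [map_span_two_pair]
  exact Ideal.exists_span_pair_eq_pow this hl

variable [NumberField K] [NumberField M] [Algebra K M] [Algebra M L] [IsScalarTower K M L]

theorem finrank_ringOfIntegers : finrank (𝓞 K) (𝓞 L) = finrank K L :=
  (IsFractionRing.finrank_eq (𝓞 K) K (𝓞 L) L).symm

theorem relNorm_eq_pow {I : Ideal (𝓞 K)} {J : Ideal (𝓞 L)} {n m : ℕ} (hn : n ≠ 0)
    (h : Ideal.map (algebraMap (𝓞 K) (𝓞 L)) I = J ^ n) (hm : finrank K L = m * n) :
    Ideal.relNorm (𝓞 K) J = I ^ m := by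
  apply Ideal.eq_of_pow_eq_pow hn
  rw [← map_pow, ← h, Ideal.relNorm_algebraMap, finrank_ringOfIntegers, hm, pow_mul]

theorem exists_relNorm_pow_eq_span (J : Ideal (𝓞 L)) : ∃ c : 𝓞 K,
    Ideal.relNorm (𝓞 K) J ^ Nat.card (ClassGroup (𝓞 M)) = Ideal.span {c} := by
  by_cases hJ : Ideal.relNorm (𝓞 M) J = ⊥
  · refine ⟨0, ?_⟩
    rw [← Ideal.relNorm_relNorm (𝓞 K) (𝓞 M), hJ, Ideal.relNorm_bot, Ideal.span_singleton_zero,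
      ← Ideal.zero_eq_bot, zero_pow Nat.card_pos.ne']
  · obtain ⟨x, hx⟩ := exists_pow_card_classGroup_eq_span hJ
    refine ⟨Algebra.intNorm (𝓞 K) (𝓞 M) x, ?_⟩
    rw [← Ideal.relNorm_relNorm (𝓞 K) (𝓞 M), ← map_pow, hx, Ideal.relNorm_singleton]

theorem span_mul_pow_ne {p q : ℕ} (hp : p.Prime) (hq : q.Prime) (hp8 : p % 8 = 5) (hq8 : q % 8 = 3)
    (h2 : finrank ℚ K = 2) {s : K} (hs : s ^ 2 = -(p * q)) {θ : 𝓞 K}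
    (hθ : algebraMap (𝓞 K) K θ = (1 + s) / 2) (hM : finrank K M = 4) (hL : finrank K L = 8)
    {𝔱 : Ideal (𝓞 M)} {𝔗 : Ideal (𝓞 L)}
    (h𝔱 : Ideal.map (algebraMap (𝓞 K) (𝓞 M)) (Ideal.span {2, θ}) = 𝔱 ^ 2)
    (h𝔗 : Ideal.map (algebraMap (𝓞 K) (𝓞 L)) (Ideal.span {2, θ}) = 𝔗 ^ 4)
    {k : ℕ} (hk : Odd k) (hk2 : 2 ≤ k) (hdvd : Nat.card (ClassGroup (𝓞 M)) ∣ k)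
    {τ : 𝓞 M} (hτ : 𝔱 ^ k = Ideal.span {τ}) {r : L} (hr : r ^ 2 = 2)
    {x y : 𝓞 L} {J : Ideal (𝓞 L)} (hx : x ≠ 0) :
    Ideal.span {x} * 𝔗 ^ k ≠ Ideal.span {y} * J ^ 2 := by
  intro h
  have hd : ∀ z : K, z ^ 2 ≠ 2 := sq_ne_two_of_sqrt_neg hp hq h2 hs
  have hγ : Ideal.span {Algebra.intNorm (𝓞 K) (𝓞 M) τ} = Ideal.span {2, θ} ^ (2 * k) := by
    rw [← Ideal.relNorm_singleton, ← hτ, map_pow, relNorm_eq_pow two_ne_zero h𝔱 (m := 2) hM, pow_mul]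
  obtain ⟨c, hc⟩ := exists_relNorm_pow_eq_span (K := K) (M := M) J
  obtain ⟨j, rfl⟩ := hdvd
  have hN := congrArg (Ideal.relNorm (𝓞 K)) h
  rw [map_mul, map_mul, Ideal.relNorm_singleton, Ideal.relNorm_singleton, map_pow, map_pow,
    relNorm_eq_pow four_ne_zero h𝔗 (m := 2) hL, ← pow_mul, ← hγ] at hN
  obtain ⟨a, b, hab⟩ := exists_norm_eq_sq_sub_mul_sq hd (r := r) (by rw [hr, map_ofNat])
    (algebraMap (𝓞 L) L y / algebraMap (𝓞 L) L x)
  have hX : Algebra.intNorm (𝓞 K) (𝓞 L) x ≠ 0 := Algebra.intNorm_ne_zero.2 hx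
  refine span_pow_mul_pow_ne hp hq hp8 hq8 h2 hs hθ hk hk2 hγ hX
    (Y := Algebra.intNorm (𝓞 K) (𝓞 L) y) (C := c ^ j) (a := a) (b := b) ?_ ?_
  · rw [Algebra.algebraMap_intNorm (K := K) (L := L), Algebra.algebraMap_intNorm (K := K) (L := L),
      ← hab, ← map_mul, mul_div_cancel₀]
    simpa using hx
  · rw [← mul_pow, hN, mul_pow, ← Ideal.span_singleton_pow, ← hc]
    ring

theorem factorization_two_card_classGroup_of_tower {p q : ℕ} (hp : p.Prime) (hq : q.Prime)
    (hp8 : p % 8 = 5) (hq8 : q % 8 = 3) (h2 : finrank ℚ K = 2) {s : K} (hs : s ^ 2 = -(p * q))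
    (hM : finrank K M = 4) (hL : finrank K L = 8) (hodd : Odd (Nat.card (ClassGroup (𝓞 M))))
    (hker : Nat.card (powMonoidHom 2 : ClassGroup (𝓞 L) →* ClassGroup (𝓞 L)).ker ∣ 2)
    {t : M} (ht : t ^ 2 = -2) {r i : L} (hr : r ^ 2 = 2) (hi : i ^ 2 = -1) :
    (Nat.card (ClassGroup (𝓞 L))).factorization 2 = 1 := by
  have hpq8 : p * q % 8 = 7 := by rw [Nat.mul_mod, hp8, hq8]
  have hs' : s ^ 2 = -((p * q : ℕ) : K) := by rw [hs, Nat.cast_mul]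
  obtain ⟨θ, hθ, -⟩ := exists_ringOfIntegers_of_quadratic (x := (1 + s) / 2) (t := 1)
    (n := (p * q + 1) / 4) (by
      have h : ((4 * ((p * q + 1) / 4) : ℤ) : K) = ((p * q + 1 : ℤ) : K) := by
        congr 1
        rw [← Nat.cast_mul]
        omega
      push_cast at h ⊢
      linear_combination hs / 4 + h / 4)
  obtain ⟨m, hm⟩ := exists_mul_one_sub_eq hpq8 hs' hθ
  obtain ⟨σ, -, hσ⟩ := exists_ringOfIntegers_of_quadratic (x := t) (t := 0) (n := 2)
    (by push_cast; linear_combination ht)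
  have hσ' : Associated (σ ^ 2) 2 := ⟨-1, by push_cast at hσ ⊢; linear_combination -hσ⟩
  have hz4 : (r * (1 + i) / 2) ^ 4 = -1 := by
    have h1 : (r * (1 + i) / 2) ^ 2 = i := by linear_combination (1 + i) ^ 2 / 4 * hr + hi / 2
    linear_combination ((r * (1 + i) / 2) ^ 2 + i) * h1 + hi
  let z : 𝓞 L := ⟨r * (1 + i) / 2, IsIntegral.of_pow (n := 4) (by norm_num) (by
    rw [hz4]
    exact isIntegral_one.neg)⟩
  let w : 𝓞 L := ⟨r, IsIntegral.of_pow (n := 2) (by norm_num) (by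
    rw [hr]
    exact map_ofNat (algebraMap ℤ L) 2 ▸ isIntegral_algebraMap)⟩
  have hw : w ^ 2 = 2 := RingOfIntegers.ext hr
  have hz : z ^ 2 + 1 = w * z := RingOfIntegers.ext (by
    change (r * (1 + i) / 2) ^ 2 + 1 = r * (r * (1 + i) / 2)
    linear_combination ((1 + i) ^ 2 / 4 - (1 + i) / 2) * hr + hi / 2)
  obtain ⟨𝔱, h𝔱⟩ := exists_span_two_pair_pow hm hσ'
  obtain ⟨𝔗, h𝔗⟩ := exists_span_two_pair_pow hm (associated_one_add_pow_four hz hw)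
  have h𝔗𝔱 : 𝔗 ^ 2 = Ideal.map (algebraMap (𝓞 M) (𝓞 L)) 𝔱 := by
    apply Ideal.eq_of_pow_eq_pow two_ne_zero
    rw [← pow_mul, ← Ideal.map_pow, ← h𝔱, Ideal.map_map, ← IsScalarTower.algebraMap_eq, h𝔗]
  have h𝔗0 : 𝔗 ≠ ⊥ := by
    rintro rfl
    have h0 : (2 : 𝓞 L) ∈ (⊥ : Ideal (𝓞 L)) ^ 4 := by
      rw [← h𝔗, map_span_two_pair]
      exact Ideal.subset_span (by simp)
    rw [← Ideal.zero_eq_bot, zero_pow four_ne_zero, Ideal.zero_eq_bot, Ideal.mem_bot] at h0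
    exact two_ne_zero h0
  have h𝔱0 : 𝔱 ≠ ⊥ := by
    rintro rfl
    rw [Ideal.map_bot, ← Ideal.zero_eq_bot, sq_eq_zero_iff] at h𝔗𝔱
    exact h𝔗0 h𝔗𝔱
  obtain ⟨τ, hτ⟩ := exists_pow_card_classGroup_eq_span h𝔱0
  have hτ3 : 𝔱 ^ (Nat.card (ClassGroup (𝓞 M)) * 3) = Ideal.span {τ ^ 3} := by
    rw [pow_mul, hτ, Ideal.span_singleton_pow]
  refine factorization_two_card_classGroup_eq_one hker
    (I := 𝔗 ^ (Nat.card (ClassGroup (𝓞 M)) * 3)) (a := algebraMap (𝓞 M) (𝓞 L) (τ ^ 3))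
    (pow_ne_zero _ h𝔗0) ?_ fun x y J hx _ _ => ?_
  · rw [← pow_mul, mul_comm _ 2, pow_mul, h𝔗𝔱, ← Ideal.map_pow, hτ3, Ideal.map_span,
      Set.image_singleton]
  · exact span_mul_pow_ne hp hq hp8 hq8 h2 hs hθ hM hL h𝔱 h𝔗 (hodd.mul (by decide))
      (by have := hodd.pos; omega) (dvd_mul_right _ _) hτ3 hr hx

end NormArgument

section Tower

open NumberField Module IntermediateField

theorem factorization_two_card_classGroup_of_quadratic_tower {K₁ K₂ K₃ L : Type*} [Field K₁]
    [Field K₂] [Field K₃] [Field L] [NumberField K₁] [NumberField K₂] [NumberField K₃] [NumberField L]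
    [Algebra K₁ K₂] [Algebra K₂ K₃] [Algebra K₃ L]
    {p q : ℕ} [Fact p.Prime] [Fact q.Prime] (hp8 : p % 8 = 5) (hq8 : q % 8 = 3)
    (hpq : ¬ IsSquare (p : ZMod q)) (h1 : finrank ℚ K₁ = 2) {s : K₁} (hs : s ^ 2 = -2)
    (h2 : finrank K₁ K₂ = 2) {r : K₂} (hr : r ^ 2 = p) (h3 : finrank K₂ K₃ = 2) {t : K₃}
    (ht : t ^ 2 = -q) (h4 : finrank K₃ L = 2) {a i : L} (ha : a ^ 2 = 2) (hi : i ^ 2 = -1) :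
    (Nat.card (ClassGroup (𝓞 L))).factorization 2 = 1 := by
  have hp : p.Prime := Fact.out
  have hq : q.Prime := Fact.out
  have hrt : (algebraMap K₂ K₃ r * t) ^ 2 = algebraMap ℚ K₃ (-(p * q)) := by
    rw [mul_pow, ← map_pow, hr, ht]
    simp
  have hpq0 : (0 : ℚ) < p * q := by exact_mod_cast mul_pos hp.pos hq.pos
  have h5 := finrank_adjoin_eq_two (Rat.sq_ne_of_neg (by linarith)) hrt
  have hgen := gen_sq_eq hrt
  generalize AdjoinSimple.gen ℚ (algebraMap K₂ K₃ r * t) = σ at hgen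
  generalize ℚ⟮algebraMap K₂ K₃ r * t⟯ = K at *
  have h6 : finrank ℚ K₃ = 2 * 2 * 2 := finrank_rat_eq (finrank_rat_eq h1 h2) h3
  have h7 : finrank K K₃ = 4 := by
    have := finrank_mul_finrank ℚ K K₃
    rw [h5, h6] at this
    omega
  have h8 : finrank K L = 8 := by
    rw [← finrank_mul_finrank K K₃ L, h7, h4]
  exact factorization_two_card_classGroup_of_tower (K := K) (M := K₃) hp hq hp8 hq8 h5
    (s := σ) (by simpa using hgen) h7 h8
    (odd_card_classGroup_sqrt_neg_prime hp8 hq8 hpq h1 hs h2 hr h3 ht)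
    (card_classGroup_two_torsion_dvd_two hp8 hq8 hpq h1 hs h2 hr h3 ht h4 hi)
    (t := algebraMap K₂ K₃ (algebraMap K₁ K₂ s))
    (by rw [← map_pow, ← map_pow, hs, map_neg, map_neg, map_ofNat, map_ofNat]) ha hi

variable {L : Type*} [Field L] [NumberField L] {p q : ℕ} [Fact p.Prime] [Fact q.Prime]

theorem factorization_two_card_classGroup_of_sqrt_neg_prime {K₁ K₂ : Type*} [Field K₁] [Field K₂]
    [NumberField K₁] [NumberField K₂] [Algebra K₁ K₂] [Algebra K₂ L]
    (hp8 : p % 8 = 5) (hq8 : q % 8 = 3) (hpq : ¬ IsSquare (p : ZMod q))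
    (h1 : finrank ℚ K₁ = 2) {s : K₁} (hs : s ^ 2 = -2) (h2 : finrank K₁ K₂ = 2) {r : K₂} (hr : r ^ 2 = p)
    {a c i : L} (ha : a ^ 2 = 2) (hc : c ^ 2 = -q) (hi : i ^ 2 = -1)
    (htop : ∀ E : Subfield L, (∀ x, algebraMap K₂ L x ∈ E) → c ∈ E → i ∈ E → E = ⊤) :
    (Nat.card (ClassGroup (𝓞 L))).factorization 2 = 1 := by
  have hp : p.Prime := Fact.out
  have hq : q.Prime := Fact.out
  have ht : c ^ 2 = algebraMap K₂ L ((-q : ℤ) : K₂) := by simp [hc]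
  have h3 : finrank K₂ K₂⟮c⟯ = 2 :=
    finrank_adjoin_eq_two (sq_ne_neg_prime hp hp8 hq hq8 h1 hs h2 hr) ht
  have ht' : AdjoinSimple.gen K₂ c ^ 2 = -q := by
    rw [gen_sq_eq ht]
    simp
  have : NumberField K₂⟮c⟯ := NumberField.of_module_finite K₂ _
  have hi' : i ^ 2 = algebraMap K₂⟮c⟯ L (-1) := by simp [hi]
  have h4 := finrank_adjoin_eq_two (sq_ne_neg_one hp hp8 hq hq8 h1 hs h2 hr h3 ht') hi'
  have h5 : K₂⟮c⟯⟮i⟯ = ⊤ := by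
    apply IntermediateField.toSubfield_injective
    refine htop _ (fun x => ?_) ?_ (mem_adjoin_simple_self _ i)
    · exact K₂⟮c⟯⟮i⟯.algebraMap_mem (algebraMap K₂ K₂⟮c⟯ x)
    · exact K₂⟮c⟯⟮i⟯.algebraMap_mem (AdjoinSimple.gen K₂ c)
  rw [h5, finrank_top'] at h4
  exact factorization_two_card_classGroup_of_quadratic_tower hp8 hq8 hpq h1 hs h2 hr h3 ht' h4 ha hi

theorem factorization_two_card_classGroup_of_sqrt_prime {K₁ : Type*} [Field K₁]
    [NumberField K₁] [Algebra K₁ L]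
    (hp8 : p % 8 = 5) (hq8 : q % 8 = 3) (hpq : ¬ IsSquare (p : ZMod q))
    (h1 : finrank ℚ K₁ = 2) {s : K₁} (hs : s ^ 2 = -2)
    {a b c i : L} (ha : a ^ 2 = 2) (hb : b ^ 2 = p) (hc : c ^ 2 = -q) (hi : i ^ 2 = -1)
    (htop : ∀ E : Subfield L, (∀ x, algebraMap K₁ L x ∈ E) → b ∈ E → c ∈ E → i ∈ E → E = ⊤) :
    (Nat.card (ClassGroup (𝓞 L))).factorization 2 = 1 := by
  have hr : b ^ 2 = algebraMap K₁ L p := by rw [hb, map_natCast]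
  have h2 := finrank_adjoin_eq_two (sq_ne_prime Fact.out hp8 h1 hs) hr
  have : NumberField K₁⟮b⟯ := NumberField.of_module_finite K₁ _
  exact factorization_two_card_classGroup_of_sqrt_neg_prime hp8 hq8 hpq h1 hs h2
    (r := AdjoinSimple.gen K₁ b) (by rw [gen_sq_eq hr, map_natCast]) ha hc hi fun E hE =>
    htop E (fun x => hE (algebraMap K₁ K₁⟮b⟯ x)) (hE (AdjoinSimple.gen K₁ b))

theorem factorization_two_card_classGroup_multiquadratic (hp8 : p % 8 = 5) (hq8 : q % 8 = 3)
    (hpq : ¬ IsSquare (p : ZMod q)) {a b c i : L} (ha : a ^ 2 = 2) (hb : b ^ 2 = p) (hc : c ^ 2 = q)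
    (hi : i ^ 2 = -1) (htop : ∀ E : Subfield L, a ∈ E → b ∈ E → c ∈ E → i ∈ E → E = ⊤) :
    (Nat.card (ClassGroup (𝓞 L))).factorization 2 = 1 := by
  have hs : (a * i) ^ 2 = algebraMap ℚ L (-2) := by
    rw [mul_pow, ha, hi]
    simp
  have h1 := finrank_adjoin_eq_two (Rat.sq_ne_of_neg (by norm_num)) hs
  refine factorization_two_card_classGroup_of_sqrt_prime hp8 hq8 hpq h1
    (s := AdjoinSimple.gen ℚ (a * i)) (by rw [gen_sq_eq hs, map_neg, map_ofNat]) ha hb (c := c * i)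
    (by rw [mul_pow, hc, hi, mul_neg_one]) hi fun E hE mb mc mi => ?_
  have key : ∀ x : L, x * i ∈ E → x ∈ E := fun x hx => by
    have := neg_mem (mul_mem hx mi)
    rwa [mul_assoc, ← sq, hi, mul_neg_one, neg_neg] at this
  exact htop E (key a (hE (AdjoinSimple.gen ℚ (a * i)))) mb (key c mc) mi

end Tower

open NumberField Module IntermediateField in
theorem twoClassNum_eq_two {K : IntermediateField ℚ ℂ}
    (h : (Nat.card (ClassGroup (𝓞 K))).factorization 2 = 1) : twoClassNum K = 2 := by
  change 2 ^ (Nat.card (ClassGroup (𝓞 K))).factorization 2 = 2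
  rw [h, pow_one]

theorem Complex.ofReal_sqrt_sq {x : ℝ} (hx : 0 ≤ x) : ((Real.sqrt x : ℝ) : ℂ) ^ 2 = x := by
  rw [← Complex.ofReal_pow, Real.sq_sqrt hx]

theorem IntermediateField.finiteDimensional_adjoin_of_sq {S : Set ℂ} [Finite S]
    (h : ∀ x ∈ S, ∃ d : ℤ, x ^ 2 = d) : FiniteDimensional ℚ (IntermediateField.adjoin ℚ S) :=
  IntermediateField.finiteDimensional_adjoin fun x hx => by
    obtain ⟨d, hd⟩ := h x hx
    exact IsIntegral.of_pow two_pos (hd ▸ map_intCast (algebraMap ℚ ℂ) d ▸ isIntegral_algebraMap)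

theorem twoClassNum_Qsqrt2_sqrtp_sqrtq_i_legendre_neg_one
    (p q : ℕ) [Fact (Nat.Prime p)] [Fact (Nat.Prime q)]
    (hp : p % 8 = 5) (hq : q % 8 = 3) (hleg : legendreSym q (p : ℤ) = -1) :
    twoClassNum (IntermediateField.adjoin ℚ
        {((Real.sqrt 2 : ℝ) : ℂ), ((Real.sqrt p : ℝ) : ℂ),
          ((Real.sqrt q : ℝ) : ℂ), Complex.I}) = 2 ∧
    twoClassNum (IntermediateField.adjoin ℚ
        {((Real.sqrt (p * q) : ℝ) : ℂ) * Complex.I}) = 2 := by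
  have hpq : ¬ IsSquare (p : ZMod q) := by
    simpa using (legendreSym.eq_neg_one_iff q).1 hleg
  have ha : ((Real.sqrt 2 : ℝ) : ℂ) ^ 2 = 2 := by
    rw [Complex.ofReal_sqrt_sq zero_le_two, Complex.ofReal_ofNat]
  have hb : ((Real.sqrt p : ℝ) : ℂ) ^ 2 = p := by
    rw [Complex.ofReal_sqrt_sq (Nat.cast_nonneg _), Complex.ofReal_natCast]
  have hc : ((Real.sqrt q : ℝ) : ℂ) ^ 2 = q := by
    rw [Complex.ofReal_sqrt_sq (Nat.cast_nonneg _), Complex.ofReal_natCast]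
  constructor
  · set S : Set ℂ := {((Real.sqrt 2 : ℝ) : ℂ), ((Real.sqrt p : ℝ) : ℂ), ((Real.sqrt q : ℝ) : ℂ),
      Complex.I} with hS
    have : FiniteDimensional ℚ (IntermediateField.adjoin ℚ S) := by
      refine IntermediateField.finiteDimensional_adjoin_of_sq ?_
      rintro _ (rfl | rfl | rfl | rfl)
      exacts [⟨2, by simp [ha]⟩, ⟨p, by simp [hb]⟩, ⟨q, by simp [hc]⟩, ⟨-1, by simp⟩]
    have : NumberField (IntermediateField.adjoin ℚ S) := { }
    have hmem : ∀ x ∈ S, x ∈ IntermediateField.adjoin ℚ S := IntermediateField.subset_adjoin ℚ S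
    refine twoClassNum_eq_two (factorization_two_card_classGroup_multiquadratic hp hq hpq
      (a := ⟨_, hmem (Real.sqrt 2 : ℝ) (by simp [hS])⟩) (b := ⟨_, hmem (Real.sqrt p : ℝ) (by simp [hS])⟩)
      (c := ⟨_, hmem (Real.sqrt q : ℝ) (by simp [hS])⟩) (i := ⟨_, hmem Complex.I (by simp [hS])⟩)
      (Subtype.ext ha) (Subtype.ext hb) (Subtype.ext hc) (Subtype.ext Complex.I_sq)
      fun E ma mb mc mi => ?_)
    have hle : IntermediateField.adjoin ℚ S ≤
        (E.map (algebraMap (IntermediateField.adjoin ℚ S) ℂ)).toIntermediateField fun x =>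
          ⟨algebraMap ℚ _ x, by simp, rfl⟩ := by
      rw [IntermediateField.adjoin_le_iff]
      rintro _ (rfl | rfl | rfl | rfl)
      exacts [⟨_, ma, rfl⟩, ⟨_, mb, rfl⟩, ⟨_, mc, rfl⟩, ⟨_, mi, rfl⟩]
    refine eq_top_iff.2 fun x _ => ?_
    obtain ⟨y, hy, hyx⟩ := hle x.2
    rwa [← Subtype.ext hyx]
  · have hs : (((Real.sqrt (p * q) : ℝ) : ℂ) * Complex.I) ^ 2 = algebraMap ℚ ℂ (-(p * q)) := by
      rw [mul_pow, Complex.ofReal_sqrt_sq (by positivity), Complex.I_sq]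
      simp
    have hpos : (0 : ℚ) < p * q :=
      mul_pos (Nat.cast_pos.2 (Fact.out : p.Prime).pos) (Nat.cast_pos.2 (Fact.out : q.Prime).pos)
    have h2 := finrank_adjoin_eq_two (Rat.sq_ne_of_neg (by linarith)) hs
    have : FiniteDimensional ℚ
        (IntermediateField.adjoin ℚ {((Real.sqrt (p * q) : ℝ) : ℂ) * Complex.I}) :=
      Module.finite_of_finrank_pos (by rw [h2]; exact two_pos)
    have : NumberField
        (IntermediateField.adjoin ℚ {((Real.sqrt (p * q) : ℝ) : ℂ) * Complex.I}) := { }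
    exact twoClassNum_eq_two (factorization_two_card_classGroup_imaginary
      (by rw [Nat.mul_mod, show p % 4 = 1 by omega, show q % 4 = 3 by omega]) hpq h2 (s := IntermediateField.AdjoinSimple.gen ℚ _)
      (by rw [gen_sq_eq hs]; simp))
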